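/- arXiv:1703.05553 — 2 statements merged into one kernel-verified Lean document; each statement's English description precedes it below -/
import Mathlib

section
/- Let d be a positive integer and let S be any subgroup of the isometry group of Euclidean space ℝ^d which does not contain a non-abelian free subgroup (i.e. no subgroup of S is isomorphic to the free group of rank 2). Then S is virtually metabelian: S has a finite index subgroup H whose commutator subgroup [H,H] is abelian. -/
universe u

/-- abstract ping-pong for reduced words -/
theorem pp_words {H X : Type*} [Group H] [MulAction H X] (a : Fin 2 → H)
    (D : Fin 2 × Bool → Set X) (hne : ∀ s, (D s).Nonempty)
    (hdisj : ∀ s t, s ≠ t → Disjoint (D s) (D t))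
    (hmap : ∀ (i : Fin 2) (e : Bool) (t : Fin 2 × Bool), t ≠ (i, !e) → ∀ x ∈ D t,
      (cond e (a i) (a i)⁻¹) • x ∈ D (i, e)) :
    Function.Injective (FreeGroup.lift a) := by
  have key : ∀ (L : List (Fin 2 × Bool)) (s : Fin 2 × Bool),
      FreeGroup.IsReduced (s :: L) → ∃ l : Fin 2 × Bool, ∀ t, t ≠ l → ∀ x ∈ D t,
        (FreeGroup.lift a (FreeGroup.mk (s :: L))) • x ∈ D s := by
    intro L
    induction L with
    | nil =>
      intro s _
      refine ⟨(s.1, !s.2), fun t ht x hx => ?_⟩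
      have := hmap s.1 s.2 t ht x hx
      simpa [FreeGroup.lift_mk] using this
    | cons r L ih =>
      intro s hs
      rw [FreeGroup.isReduced_cons_cons] at hs
      obtain ⟨l, hl⟩ := ih r hs.2
      refine ⟨l, fun t ht x hx => ?_⟩
      have h1 := hl t ht x hx
      have h2 : r ≠ (s.1, !s.2) := by
        intro h
        have := hs.1 (by rw [h])
        rw [h] at this
        cases hh : s.2 <;> simp [hh] at this
      have := hmap s.1 s.2 r h2 _ h1
      have e : FreeGroup.lift a (FreeGroup.mk (s :: r :: L)) =
          (cond s.2 (a s.1) (a s.1)⁻¹) * FreeGroup.lift a (FreeGroup.mk (r :: L)) := by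
        simp [FreeGroup.lift_mk]
      rw [e, mul_smul]
      exact this
  rw [injective_iff_map_eq_one]
  intro w hw
  by_contra hne1
  have hmk : FreeGroup.mk w.toWord = w := FreeGroup.mk_toWord
  have hred : FreeGroup.IsReduced w.toWord := FreeGroup.isReduced_toWord
  rcases hL : w.toWord with _ | ⟨s, L⟩
  · apply hne1
    rw [← hmk, hL]; rfl
  · rw [hL] at hred hmk
    obtain ⟨l, hl⟩ := key L s hred
    obtain ⟨t, ht1, ht2⟩ : ∃ t : Fin 2 × Bool, t ≠ l ∧ t ≠ s := by
      have hdec : ∀ l s : Fin 2 × Bool, ∃ t : Fin 2 × Bool, t ≠ l ∧ t ≠ s := by decide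
      exact hdec l s
    obtain ⟨x, hx⟩ := hne t
    have := hl t ht1 x hx
    rw [hmk, hw, one_smul] at this
    exact Set.disjoint_left.mp (hdisj t s ht2) hx this


theorem exists_fin_bound {ι : Type*} [Finite ι] (f : ι → ℝ) : ∃ C : ℝ, 1 ≤ C ∧ ∀ i, f i ≤ C := by
  obtain ⟨C, hC⟩ := (Set.finite_range f).bddAbove
  exact ⟨max 1 C, le_max_left _ _, fun i => (hC ⟨i, rfl⟩).trans (le_max_right _ _)⟩

open scoped Matrix.Norms.Operator in
set_option maxHeartbeats 1000000 in
theorem pp_matrix {k n H : Type*} [NormedField k] [Fintype n] [DecidableEq n] [Group H]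
    (ρ : H →* Matrix n n k) (T : Fin 2 × Bool → Matrix n n k)
    (hT0 : ∀ s, T s ≠ 0)
    (hL : ∀ s t, t ≠ (s.1, !s.2) → ∃ L, L * (T s * T t) = T t)
    (hK : ∀ s, T (s.1, !s.2) * T s = 0)
    (happ : ∀ ε : ℝ, 0 < ε → ∃ a : Fin 2 → H, ∀ i e, ∃ c : k,
      ‖c • ρ (cond e (a i) (a i)⁻¹) - T (i, e)‖ < ε) :
    ∃ f : FreeGroup (Fin 2) →* H, Function.Injective f := by
  classical
  choose! L hL using hL
  obtain ⟨C, hC1, hCT, hCL⟩ : ∃ C : ℝ, 1 ≤ C ∧ (∀ s, ‖T s‖ ≤ C) ∧ (∀ s t, ‖L s t‖ ≤ C) := by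
    obtain ⟨C1, h1, h1'⟩ := exists_fin_bound (fun s => ‖T s‖)
    obtain ⟨C2, h2, h2'⟩ := exists_fin_bound (fun p : (Fin 2 × Bool) × (Fin 2 × Bool) => ‖L p.1 p.2‖)
    exact ⟨max C1 C2, h1.trans (le_max_left _ _), fun s => (h1' s).trans (le_max_left _ _),
      fun s t => (h2' (s, t)).trans (le_max_right _ _)⟩
  have hC0 : 0 < C := by linarith
  set δ : ℝ := 1 / (8 * C ^ 2) with hδ
  have hδ0 : 0 < δ := by positivity
  have hδC : C * δ = 1 / (8 * C) := by rw [hδ]; field_simp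
  have hδ1 : δ ≤ 1 / 8 := by
    rw [hδ]; apply one_div_le_one_div_of_le (by norm_num); nlinarith
  let D : Fin 2 × Bool → Set (n → k) := fun s =>
    {x | x ≠ 0 ∧ ∃ y, ‖x - (T s).mulVec y‖ ≤ δ * ‖x‖}
  have bnd : ∀ (A : Matrix n n k) (B : ℝ) (x : n → k), ‖A‖ ≤ B → ‖A.mulVec x‖ ≤ B * ‖x‖ := by
    intro A B x h
    exact (Matrix.linfty_opNorm_mulVec A x).trans
      (mul_le_mul_of_nonneg_right h (norm_nonneg _))
  have fact1 : ∀ s t, t ≠ (s.1, !s.2) → ∀ x ∈ D t,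
      3 / (4 * C) * ‖x‖ ≤ ‖(T s).mulVec x‖ := by
    rintro s t hst x ⟨hx0, y, hy⟩
    set u := (T t).mulVec y with hu
    have h1 : ‖u‖ ≤ C * ‖(T s).mulVec u‖ := by
      have : u = (L s t).mulVec ((T s).mulVec u) := by
        rw [hu, Matrix.mulVec_mulVec, Matrix.mulVec_mulVec, Matrix.mul_assoc, hL s t hst]
      calc ‖u‖ = ‖(L s t).mulVec ((T s).mulVec u)‖ := by rw [← this]
        _ ≤ _ := bnd _ _ _ (hCL s t)
    have h2 : ‖(T s).mulVec x - (T s).mulVec u‖ ≤ C * (δ * ‖x‖) := by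
      rw [← Matrix.mulVec_sub]
      exact (bnd _ _ _ (hCT s)).trans (mul_le_mul_of_nonneg_left hy hC0.le)
    have h3 : ‖(T s).mulVec u‖ ≤ ‖(T s).mulVec x‖ + C * (δ * ‖x‖) := by
      have := norm_sub_norm_le ((T s).mulVec u) ((T s).mulVec x)
      rw [norm_sub_rev] at this
      linarith
    have h4 : ‖x‖ - δ * ‖x‖ ≤ ‖u‖ := by
      have := norm_sub_norm_le x u
      linarith
    have hxn := norm_nonneg x
    have h5 : 7 / 8 * ‖x‖ ≤ C * ‖(T s).mulVec u‖ := by nlinarith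
    have h6 : 7 / (8 * C) * ‖x‖ ≤ ‖(T s).mulVec u‖ := by
      rw [show 7 / (8 * C) * ‖x‖ = (7 / 8 * ‖x‖) / C by field_simp]
      rw [div_le_iff₀ hC0]; linarith
    have h7 : C * (δ * ‖x‖) = 1 / (8 * C) * ‖x‖ := by rw [← mul_assoc, hδC]
    have h8 : 3 / (4 * C) * ‖x‖ = 7 / (8 * C) * ‖x‖ - 1 / (8 * C) * ‖x‖ := by
      field_simp; ring
    linarith
  have fact2 : ∀ s, ∀ x ∈ D s, ‖(T (s.1, !s.2)).mulVec x‖ ≤ 1 / (8 * C) * ‖x‖ := by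
    rintro s x ⟨hx0, y, hy⟩
    have : (T (s.1, !s.2)).mulVec x = (T (s.1, !s.2)).mulVec (x - (T s).mulVec y) := by
      rw [Matrix.mulVec_sub, Matrix.mulVec_mulVec, hK]; simp
    rw [this]
    calc _ ≤ C * ‖x - (T s).mulVec y‖ := bnd _ _ _ (hCT _)
      _ ≤ C * (δ * ‖x‖) := mul_le_mul_of_nonneg_left hy hC0.le
      _ = _ := by rw [← mul_assoc, hδC]
  obtain ⟨a, ha⟩ := happ (δ / (2 * C)) (by positivity)
  let _ : MulAction H (n → k) :=
    { smul := fun h x => (ρ h).mulVec x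
      one_smul := fun x => by change (ρ 1).mulVec x = x; simp
      mul_smul := fun g h x => by
        change (ρ (g * h)).mulVec x = (ρ g).mulVec ((ρ h).mulVec x); simp }
  refine ⟨FreeGroup.lift a, pp_words a D ?_ ?_ ?_⟩
  · intro s
    obtain ⟨y, hy⟩ : ∃ y, (T s).mulVec y ≠ 0 := by
      by_contra! h
      apply hT0 s
      exact Matrix.mulVec_injective (funext fun y => by simpa using h y)
    exact ⟨(T s).mulVec y, hy, y, by simp; positivity⟩
  · intro s t hst
    rw [Set.disjoint_left]
    intro x hs ht
    have h1 := fact1 (s.1, !s.2) t (by simpa using hst.symm) x ht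
    have h2 := fact2 s x hs
    have hx : 0 < ‖x‖ := norm_pos_iff.mpr hs.1
    have h3 : 1 / (8 * C) < 3 / (4 * C) := by
      rw [div_lt_div_iff₀ (by positivity) (by positivity)]; linarith
    nlinarith
  · intro i e t ht x hx
    obtain ⟨c, hc⟩ := ha i e
    change (ρ (cond e (a i) (a i)⁻¹)).mulVec x ∈ D (i, e)
    set z := (ρ (cond e (a i) (a i)⁻¹)).mulVec x with hz
    have h1 := fact1 (i, e) t ht x hx
    have h2 : ‖c • z - (T (i, e)).mulVec x‖ ≤ δ / (2 * C) * ‖x‖ := by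
      rw [hz, ← Matrix.smul_mulVec, ← Matrix.sub_mulVec]
      exact bnd _ _ _ hc.le
    have hx0 : 0 < ‖x‖ := norm_pos_iff.mpr hx.1
    have h3 : ‖(T (i, e)).mulVec x‖ ≤ ‖c • z‖ + δ / (2 * C) * ‖x‖ := by
      have := norm_sub_norm_le ((T (i, e)).mulVec x) (c • z)
      rw [norm_sub_rev] at this
      linarith
    have h4 : 1 / (2 * C) * ‖x‖ ≤ ‖c • z‖ := by
      have e1 : δ / (2 * C) * ‖x‖ ≤ 1 / 8 / (2 * C) * ‖x‖ := by gcongr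
      have e2 : 3 / (4 * C) * ‖x‖ - 1 / 8 / (2 * C) * ‖x‖ - 1 / (2 * C) * ‖x‖ =
        3 / (16 * C) * ‖x‖ := by field_simp; ring
      have e3 : 0 ≤ 3 / (16 * C) * ‖x‖ := by positivity
      linarith
    have h5 : 0 < ‖c • z‖ := lt_of_lt_of_le (by positivity) h4
    have h6 : c ≠ 0 := by rintro rfl; simp at h5
    have h7 : z ≠ 0 := by intro h; rw [h] at h5; simp at h5
    refine ⟨h7, c⁻¹ • x, ?_⟩
    have h8 : z - (T (i, e)).mulVec (c⁻¹ • x) = c⁻¹ • (c • z - (T (i, e)).mulVec x) := by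
      rw [smul_sub, smul_smul, inv_mul_cancel₀ h6, one_smul, Matrix.mulVec_smul]
    have h9 : δ / (2 * C) * ‖x‖ ≤ δ * ‖c • z‖ := by
      calc _ = δ * (1 / (2 * C) * ‖x‖) := by ring
        _ ≤ _ := by gcongr
    rw [h8, norm_smul, norm_inv]
    rw [norm_smul] at h9
    have hcp : 0 < ‖c‖ := norm_pos_iff.mpr h6
    calc ‖c‖⁻¹ * ‖c • z - (T (i, e)).mulVec x‖ ≤ ‖c‖⁻¹ * (δ * (‖c‖ * ‖z‖)) := by
          gcongr; exact h2.trans h9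
      _ = δ * ‖z‖ := by field_simp


theorem exists_left_factor {k n : Type*} [Field k] [Fintype n] [DecidableEq n]
    (A B : Matrix n n k) (h : (A * B).rank = B.rank) : ∃ L, L * (A * B) = B := by
  let a := Matrix.toLin' A
  let b := Matrix.toLin' B
  have h1 : Module.finrank k (LinearMap.range (a.domRestrict (LinearMap.range b))) =
      Module.finrank k (LinearMap.range b) := by
    have e : LinearMap.range (a.domRestrict (LinearMap.range b)) = LinearMap.range (a ∘ₗ b) := by
      rw [LinearMap.range_domRestrict, LinearMap.range_comp]
    rw [e]
    rw [Matrix.rank_eq_finrank_range_toLin _ (Pi.basisFun k n) (Pi.basisFun k n),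
      Matrix.rank_eq_finrank_range_toLin _ (Pi.basisFun k n) (Pi.basisFun k n)] at h
    simp only [Matrix.toLin_eq_toLin'] at h
    have e2 : a ∘ₗ b = Matrix.toLin' (A * B) := (Matrix.toLin'_mul A B).symm
    rw [e2]
    exact h
  have h2 := LinearMap.finrank_range_add_finrank_ker (a.domRestrict (LinearMap.range b))
  have h3 : LinearMap.ker (a.domRestrict (LinearMap.range b)) = ⊥ := by
    rw [← Submodule.finrank_eq_zero (R := k)]; omega
  obtain ⟨g, hg⟩ := LinearMap.exists_leftInverse_of_injective _ h3
  refine ⟨LinearMap.toMatrix' ((LinearMap.range b).subtype ∘ₗ g), ?_⟩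
  apply Matrix.toLin'.injective
  rw [Matrix.toLin'_mul, Matrix.toLin'_mul, Matrix.toLin'_toMatrix']
  ext1 x
  have := LinearMap.congr_fun hg ⟨b (Pi.single x 1), ⟨_, rfl⟩⟩
  have := congrArg Subtype.val this
  ext y
  simpa [a, b] using congrFun this y

theorem approx_pow {k n : Type*} [NormedField k] [Fintype n]
    (hrec : ∀ F : Finset k, (∀ x ∈ F, ‖x‖ = 1) → ∀ ε : ℝ, 0 < ε → ∀ N : ℕ, ∃ m, N ≤ m ∧
      ∀ x ∈ F, ‖x ^ m - 1‖ < ε)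
    (e : n → k) (he : ∀ i, ‖e i‖ ≤ 1) (ε : ℝ) (hε : 0 < ε) :
    ∃ m : ℕ, ∀ i, ‖e i ^ m - (if ‖e i‖ = 1 then 1 else 0)‖ < ε := by
  classical
  have h1 : ∀ᶠ m : ℕ in Filter.atTop, ∀ i, ‖e i‖ ≠ 1 → ‖e i ^ m‖ < ε := by
    rw [Filter.eventually_all]
    intro i
    by_cases h : ‖e i‖ = 1
    · simp [h]
    · have : Filter.Tendsto (fun m : ℕ => ‖e i‖ ^ m) Filter.atTop (nhds 0) :=
        tendsto_pow_atTop_nhds_zero_of_lt_one (norm_nonneg _) (lt_of_le_of_ne (he i) h)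
      filter_upwards [this.eventually (gt_mem_nhds hε)] with m hm _
      rw [norm_pow]; exact hm
  obtain ⟨N, hN⟩ := Filter.eventually_atTop.mp h1
  obtain ⟨m, hm, hm'⟩ := hrec ((Finset.univ.filter fun i => ‖e i‖ = 1).image e)
    (by intro x hx; simp only [Finset.mem_image, Finset.mem_filter] at hx
        obtain ⟨i, hi, rfl⟩ := hx; exact hi.2) ε hε N
  refine ⟨m, fun i => ?_⟩
  by_cases h : ‖e i‖ = 1
  · rw [if_pos h]
    exact hm' _ (Finset.mem_image.mpr ⟨i, by simp [h], rfl⟩)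
  · rw [if_neg h, sub_zero]
    exact hN m hm i h

open scoped Matrix.Norms.Operator in
/-- limits of pairs of scaled group elements and inverses -/
def limPairs {k n H : Type*} [NormedField k] [Fintype n] [DecidableEq n] [Group H]
    (ρ : H →* Matrix n n k) : Set (Matrix n n k × Matrix n n k) :=
  closure {p | ∃ (h : H) (c c' : k), p = (c • ρ h, c' • ρ h⁻¹)}

section
variable {k n H : Type*} [NormedField k] [Fintype n] [DecidableEq n] [Group H]
    (ρ : H →* Matrix n n k)

open scoped Matrix.Norms.Operator

theorem limPairs_of (h : H) : (ρ h, ρ h⁻¹) ∈ limPairs ρ :=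
  subset_closure ⟨h, 1, 1, by simp⟩

theorem limPairs_swap {p : Matrix n n k × Matrix n n k} (hp : p ∈ limPairs ρ) :
    (p.2, p.1) ∈ limPairs ρ := by
  refine map_mem_closure (f := Prod.swap) continuous_swap hp ?_
  rintro _ ⟨h, c, c', rfl⟩
  exact ⟨h⁻¹, c', c, by simp⟩

theorem limPairs_mul {p q : Matrix n n k × Matrix n n k} (hp : p ∈ limPairs ρ)
    (hq : q ∈ limPairs ρ) : (p.1 * q.1, q.2 * p.2) ∈ limPairs ρ := by
  refine map_mem_closure₂ (f := fun (p q : Matrix n n k × Matrix n n k) =>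
    (p.1 * q.1, q.2 * p.2)) ?_ hp hq ?_
  · unfold Function.uncurry
    fun_prop
  rintro _ ⟨h, c, c', rfl⟩ _ ⟨g, b, b', rfl⟩
  refine ⟨h * g, c * b, b' * c', ?_⟩
  simp [smul_smul, mul_comm]

theorem limPairs_conj {T T' : Matrix n n k} (hp : (T, T') ∈ limPairs ρ) (h : H) :
    (T * ρ h * T', T * ρ h⁻¹ * T') ∈ limPairs ρ := by
  have := limPairs_mul ρ (limPairs_mul ρ hp (limPairs_of ρ h)) (limPairs_swap ρ hp)
  simpa [mul_assoc] using this

theorem limPairs_central {T T' : Matrix n n k} (hp : (T, T') ∈ limPairs ρ) :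
    ∃ c : k, T * T' = Matrix.scalar n c := by
  have key : ∀ X : Matrix n n k, ∀ p ∈ limPairs ρ, (p.1 * p.2) * X = X * (p.1 * p.2) := by
    intro X
    have hc : IsClosed {p : Matrix n n k × Matrix n n k | (p.1 * p.2) * X = X * (p.1 * p.2)} :=
      isClosed_eq (by fun_prop) (by fun_prop)
    intro p hp
    refine closure_minimal ?_ hc hp
    rintro _ ⟨h, c, c', rfl⟩
    have : ρ h * ρ h⁻¹ = 1 := by rw [← map_mul]; simp
    simp [this]
  obtain ⟨c, hc⟩ := Matrix.mem_range_scalar_of_commute_single (M := T * T')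
    (fun i j _ => (key _ _ hp).symm)
  exact ⟨c, hc.symm⟩

theorem limPairs_zero {T T' : Matrix n n k} (hp : (T, T') ∈ limPairs ρ)
    (hr : T.rank < Fintype.card n) : T * T' = 0 := by
  obtain ⟨c, hc⟩ := limPairs_central ρ hp
  by_cases h0 : c = 0
  · rw [hc, h0]; simp
  · exfalso
    have h1 : (T * T').rank ≤ T.rank := Matrix.rank_mul_le_left _ _
    have h2 : IsUnit (T * T') := by
      rw [hc]; exact (IsUnit.mk0 c h0).map _
    rw [Matrix.rank_of_isUnit _ h2] at h1
    omega

theorem limPairs_diag (g : H) (d : n → k) (hg : ρ g = Matrix.diagonal d)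
    (hrec : ∀ F : Finset k, (∀ x ∈ F, ‖x‖ = 1) → ∀ ε : ℝ, 0 < ε → ∀ N : ℕ, ∃ m, N ≤ m ∧
      ∀ x ∈ F, ‖x ^ m - 1‖ < ε) (i j : n) (hij : ‖d i‖ ≠ ‖d j‖) :
    ∃ T T' : Matrix n n k, (T, T') ∈ limPairs ρ ∧ T ≠ 0 ∧ T' ≠ 0 ∧ T.rank < Fintype.card n := by
  have hmul : ρ g * ρ g⁻¹ = 1 := by rw [← map_mul]; simp
  have hd0 : ∀ i, d i ≠ 0 := by
    intro i hi
    have := congrFun (congrFun hmul i) i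
    rw [hg, Matrix.diagonal_mul, hi] at this
    simp at this
  have hginv : ρ g⁻¹ = Matrix.diagonal (fun i => (d i)⁻¹) := by
    have h2 : Matrix.diagonal (fun i => (d i)⁻¹) * ρ g = 1 := by
      rw [hg, Matrix.diagonal_mul_diagonal, ← Matrix.diagonal_one]
      congr 1; ext i; exact inv_mul_cancel₀ (hd0 i)
    exact (left_inv_eq_right_inv h2 hmul).symm
  have : Nonempty n := ⟨i⟩
  obtain ⟨a, ha⟩ := Finite.exists_max (fun i => ‖d i‖)
  obtain ⟨b, hb⟩ := Finite.exists_min (fun i => ‖d i‖)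
  let e : n ⊕ n → k := Sum.elim (fun i => d i / d a) (fun i => d b / d i)
  have he : ∀ x, ‖e x‖ ≤ 1 := by
    rintro (x | x)
    · simp only [e, Sum.elim_inl, norm_div]
      exact div_le_one_of_le₀ (ha x) (norm_nonneg _)
    · simp only [e, Sum.elim_inr, norm_div]
      exact div_le_one_of_le₀ (hb x) (norm_nonneg _)
  let P : n → k := fun i => if ‖e (Sum.inl i)‖ = 1 then 1 else 0
  let Q : n → k := fun i => if ‖e (Sum.inr i)‖ = 1 then 1 else 0
  refine ⟨Matrix.diagonal P, Matrix.diagonal Q, ?_, ?_, ?_, ?_⟩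
  · refine Metric.mem_closure_iff.mpr ?_
    intro ε hε
    obtain ⟨m, hm⟩ := approx_pow hrec e he ε hε
    refine ⟨_, ⟨g ^ m, (d a ^ m)⁻¹, d b ^ m, rfl⟩, ?_⟩
    rw [dist_comm, Prod.dist_eq, max_lt_iff, dist_eq_norm, dist_eq_norm]
    constructor
    · have : (d a ^ m)⁻¹ • ρ (g ^ m) - Matrix.diagonal P =
          Matrix.diagonal (fun i => e (Sum.inl i) ^ m - P i) := by
        rw [map_pow, hg, Matrix.diagonal_pow, ← Matrix.diagonal_smul, Matrix.diagonal_sub]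
        congr 1; ext i; simp [e, div_eq_inv_mul, mul_pow]
      simp only [this]
      rw [Matrix.linfty_opNorm_diagonal, pi_norm_lt_iff hε]
      exact fun i => hm (Sum.inl i)
    · have : (d b ^ m) • ρ (g ^ m)⁻¹ - Matrix.diagonal Q =
          Matrix.diagonal (fun i => e (Sum.inr i) ^ m - Q i) := by
        rw [← inv_pow, map_pow, hginv, Matrix.diagonal_pow, ← Matrix.diagonal_smul,
          Matrix.diagonal_sub]
        congr 1; ext i; simp [e, div_eq_mul_inv, mul_pow]
      simp only [this]
      rw [Matrix.linfty_opNorm_diagonal, pi_norm_lt_iff hε]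
      exact fun i => hm (Sum.inr i)
  · intro h
    have := congrFun (congrFun h a) a
    simp [P, e, hd0] at this
  · intro h
    have := congrFun (congrFun h b) b
    simp [Q, e, hd0] at this
  · classical
    rw [Matrix.rank_diagonal]
    obtain ⟨x, hx⟩ : ∃ x, ‖d x‖ ≠ ‖d a‖ := by
      by_contra! h
      exact hij ((h i).trans (h j).symm)
    apply Fintype.card_subtype_lt (x := x)
    have : ‖d a‖ ≠ 0 := norm_ne_zero_iff.mpr (hd0 a)
    simp only [P, e, Sum.elim_inl, norm_div, not_not, ite_eq_right_iff, one_ne_zero, imp_false,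
      ne_eq]
    rw [div_eq_one_iff_eq this]
    exact hx
end


open scoped Matrix.Norms.Operator in
set_option maxHeartbeats 1000000 in
theorem pp_main {k n H : Type*} [NormedField k] [Fintype n] [DecidableEq n] [Group H]
    (ρ : H →* Matrix n n k)
    (gen : ∀ F : Finset (Matrix n n k), (∀ A ∈ F, A ≠ 0) →
      ∃ h, ∀ A ∈ F, ∀ B ∈ F, A * ρ h * B ≠ 0 ∧ A * ρ h⁻¹ * B ≠ 0)
    (hrec : ∀ F : Finset k, (∀ x ∈ F, ‖x‖ = 1) → ∀ ε : ℝ, 0 < ε → ∀ N : ℕ, ∃ m, N ≤ m ∧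
      ∀ x ∈ F, ‖x ^ m - 1‖ < ε)
    (g : H) (d : n → k) (hg : ρ g = Matrix.diagonal d) (i j : n) (hij : ‖d i‖ ≠ ‖d j‖) :
    ∃ f : FreeGroup (Fin 2) →* H, Function.Injective f := by
  classical
  let Pr : ℕ → Prop := fun r => ∃ T T' : Matrix n n k, (T, T') ∈ limPairs ρ ∧ T ≠ 0 ∧ T' ≠ 0 ∧
    T.rank = r
  obtain ⟨P, Q, hPQ, hP0, hQ0, hPr⟩ := limPairs_diag ρ g d hg hrec i j hij
  have hex : ∃ r, Pr r := ⟨_, P, Q, hPQ, hP0, hQ0, rfl⟩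
  set r := Nat.find hex with hr
  have hmin : ∀ {T T' : Matrix n n k}, (T, T') ∈ limPairs ρ → T ≠ 0 → T' ≠ 0 → r ≤ T.rank :=
    fun h1 h2 h3 => Nat.find_min' hex ⟨_, _, h1, h2, h3, rfl⟩
  have hrn : r < Fintype.card n := (hmin hPQ hP0 hQ0).trans_lt hPr
  have hinv : ∀ h : H, ρ h * ρ h⁻¹ = 1 := fun h => by rw [← map_mul]; simp
  have hinv' : ∀ h : H, ρ h⁻¹ * ρ h = 1 := fun h => by rw [← map_mul]; simp
  -- both of rank r
  obtain ⟨T, T', hT, hT0, hT0', hTr, hTr'⟩ : ∃ T T' : Matrix n n k, (T, T') ∈ limPairs ρ ∧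
      T ≠ 0 ∧ T' ≠ 0 ∧ T.rank = r ∧ T'.rank = r := by
    obtain ⟨T, T', h1, h2, h3, h4⟩ := Nat.find_spec hex
    obtain ⟨h, hh⟩ := gen {T, T'} (by simp [h2, h3])
    have hh := hh T (by simp) T' (by simp)
    have hm := limPairs_conj ρ h1 h
    refine ⟨_, _, hm, hh.1, hh.2, ?_, ?_⟩
    · refine le_antisymm ?_ (hmin hm hh.1 hh.2)
      rw [mul_assoc]
      exact (Matrix.rank_mul_le_left _ _).trans h4.le
    · refine le_antisymm ?_ (hmin (limPairs_swap ρ hm) hh.2 hh.1)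
      rw [mul_assoc]
      exact (Matrix.rank_mul_le_left _ _).trans h4.le
  -- squares nonzero
  obtain ⟨T, T', hT, hT0, hT0', hTr, hTr', hTT, hTT'⟩ : ∃ T T' : Matrix n n k,
      (T, T') ∈ limPairs ρ ∧
      T ≠ 0 ∧ T' ≠ 0 ∧ T.rank = r ∧ T'.rank = r ∧ T * T ≠ 0 ∧ T' * T' ≠ 0 := by
    obtain ⟨h, hh⟩ := gen {T, T'} (by simp [hT0, hT0'])
    have h1 := (hh T (by simp) T (by simp)).1
    have h2 := (hh T' (by simp) T' (by simp)).2
    have hm := limPairs_mul ρ hT (limPairs_of ρ h)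
    have e1 : (T * ρ h) * (T * ρ h) ≠ 0 := by
      intro h0
      apply h1
      have := congrArg (· * ρ h⁻¹) h0
      simpa [mul_assoc, hinv] using this
    have e2 : (ρ h⁻¹ * T') * (ρ h⁻¹ * T') ≠ 0 := by
      intro h0
      apply h2
      have := congrArg (ρ h * ·) h0
      simpa [← mul_assoc, hinv] using this
    have e3 : T * ρ h ≠ 0 := fun h0 => e1 (by rw [h0]; simp)
    have e4 : ρ h⁻¹ * T' ≠ 0 := fun h0 => e2 (by rw [h0]; simp)
    refine ⟨_, _, hm, e3, e4, ?_, ?_, e1, e2⟩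
    · exact le_antisymm ((Matrix.rank_mul_le_left _ _).trans hTr.le) (hmin hm e3 e4)
    · exact le_antisymm ((Matrix.rank_mul_le_right _ _).trans hTr'.le)
        (hmin (limPairs_swap ρ hm) e4 e3)
  obtain ⟨κ, hκ⟩ := gen {T, T'} (by simp [hT0, hT0'])
  have hTz : T * T' = 0 := limPairs_zero ρ hT (by omega)
  have hTz' : T' * T = 0 := limPairs_zero ρ (limPairs_swap ρ hT) (by omega)
  let q : Bool → Matrix n n k := fun e => cond e T T'
  have hq0 : ∀ e, q e ≠ 0 := by rintro (_ | _) <;> assumption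
  have hqr : ∀ e, (q e).rank = r := by rintro (_ | _) <;> assumption
  have hqL : ∀ e, (q e, q (!e)) ∈ limPairs ρ := by
    rintro (_ | _)
    · exact limPairs_swap ρ hT
    · exact hT
  have hqz : ∀ e, q (!e) * q e = 0 := by rintro (_ | _) <;> assumption
  have hqq : ∀ e, q e * q e ≠ 0 := by rintro (_ | _) <;> assumption
  have hqF : ∀ e, q e ∈ ({T, T'} : Finset (Matrix n n k)) := by rintro (_ | _) <;> simp [q]
  have hqκ : ∀ e e', q e * ρ κ * q e' ≠ 0 ∧ q e * ρ κ⁻¹ * q e' ≠ 0 :=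
    fun e e' => hκ _ (hqF e) _ (hqF e')
  -- rank of products
  have rk1 : ∀ e, (q e * q e).rank = r := by
    intro e
    refine le_antisymm ((Matrix.rank_mul_le_left _ _).trans (hqr e).le) ?_
    have := limPairs_mul ρ (hqL e) (hqL e)
    exact hmin this (hqq e) (hqq _)
  have rk2 : ∀ e e' h, q e * ρ h * q e' ≠ 0 → q (!e') * ρ h⁻¹ * q (!e) ≠ 0 →
      (q e * ρ h * q e').rank = r := by
    intro e e' h h1 h2
    refine le_antisymm ((Matrix.rank_mul_le_right _ _).trans (hqr e').le) ?_
    have := limPairs_mul ρ (limPairs_mul ρ (hqL e) (limPairs_of ρ h)) (hqL e')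
    rw [← mul_assoc] at this
    exact hmin this h1 h2
  let c : Fin 2 → H := fun i => if i = 0 then 1 else κ
  have hcc : ∀ i j : Fin 2, i ≠ j → c i = 1 ∧ c j = κ ∨ c i = κ ∧ c j = 1 := by
    intro i j h
    rcases Fin.exists_fin_two.mp ⟨i, rfl⟩ with hi | hi <;>
    rcases Fin.exists_fin_two.mp ⟨j, rfl⟩ with hj | hj <;> subst hi <;> subst hj
    · exact absurd rfl h
    · exact Or.inl ⟨rfl, rfl⟩
    · exact Or.inr ⟨rfl, rfl⟩
    · exact absurd rfl h
  have rk3 : ∀ (x y : H) (e e' : Bool), (q e * ρ (x⁻¹ * y) * q e').rank = r →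
      ∃ L, L * ((ρ x * q e * ρ x⁻¹) * (ρ y * q e' * ρ y⁻¹)) = ρ y * q e' * ρ y⁻¹ := by
    intro x y e e' h
    obtain ⟨L, hL⟩ := exists_left_factor (q e * ρ (x⁻¹ * y)) (q e') (by rw [h, hqr])
    refine ⟨ρ y * L * ρ x⁻¹, ?_⟩
    calc _ = ρ y * L * (ρ x⁻¹ * ρ x) * q e * (ρ x⁻¹ * ρ y) * q e' * ρ y⁻¹ := by
            simp only [mul_assoc]
      _ = ρ y * (L * (q e * ρ (x⁻¹ * y) * q e')) * ρ y⁻¹ := by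
            rw [hinv', map_mul]; simp only [mul_assoc, one_mul]
      _ = _ := by rw [hL]
  refine pp_matrix ρ (fun s => ρ (c s.1) * q s.2 * ρ (c s.1)⁻¹) ?_ ?_ ?_ ?_
  · rintro ⟨i, e⟩ h0
    apply hq0 e
    have h1 := congrArg (fun M => ρ (c i)⁻¹ * M * ρ (c i)) h0
    dsimp only at h1
    rw [mul_zero, zero_mul] at h1
    rw [← h1, ← mul_assoc, ← mul_assoc, hinv', one_mul, mul_assoc, hinv', mul_one]
  · rintro ⟨i, e⟩ ⟨j, e'⟩ hst
    dsimp only at hst ⊢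
    apply rk3
    by_cases hij : i = j
    · subst hij
      have : e' = e := by
        by_contra hne
        apply hst
        cases e <;> cases e' <;> simp_all
      subst this
      simp only [inv_mul_cancel, map_one, mul_one]
      exact rk1 _
    · apply rk2
      · have : c i = 1 ∧ c j = κ ∨ c i = κ ∧ c j = 1 := hcc i j hij
        rcases this with ⟨h1, h2⟩ | ⟨h1, h2⟩
        · rw [h1, h2]; simpa using (hqκ e e').1
        · rw [h1, h2]; simpa using (hqκ e e').2
      · have : c i = 1 ∧ c j = κ ∨ c i = κ ∧ c j = 1 := hcc i j hij
        rcases this with ⟨h1, h2⟩ | ⟨h1, h2⟩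
        · rw [h1, h2]; simpa using (hqκ (!e') (!e)).2
        · rw [h1, h2]; simpa using (hqκ (!e') (!e)).1
  · rintro ⟨i, e⟩
    dsimp only
    calc _ = ρ (c i) * q (!e) * (ρ (c i)⁻¹ * ρ (c i)) * q e * ρ (c i)⁻¹ := by
            simp only [mul_assoc]
      _ = ρ (c i) * (q (!e) * q e) * ρ (c i)⁻¹ := by
            rw [hinv']; simp only [mul_assoc, one_mul]
      _ = 0 := by rw [hqz]; simp
  · intro ε hε
    obtain ⟨C, hC1, hC⟩ := exists_fin_bound (fun i : Fin 2 => ‖ρ (c i)‖ * ‖ρ (c i)⁻¹‖)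
    have hC0 : 0 < C := by linarith
    obtain ⟨_, ⟨a, b, b', rfl⟩, hab⟩ := Metric.mem_closure_iff.mp hT (ε / C) (by positivity)
    rw [dist_comm, Prod.dist_eq, max_lt_iff, dist_eq_norm, dist_eq_norm] at hab
    have key : ∀ (i : Fin 2) (M : Matrix n n k), ‖M‖ < ε / C → ‖ρ (c i) * M * ρ (c i)⁻¹‖ < ε := by
      intro i M hM
      calc ‖ρ (c i) * M * ρ (c i)⁻¹‖ ≤ ‖ρ (c i)‖ * ‖M‖ * ‖ρ (c i)⁻¹‖ :=
            (norm_mul_le _ _).trans (mul_le_mul_of_nonneg_right (norm_mul_le _ _) (norm_nonneg _))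
        _ = (‖ρ (c i)‖ * ‖ρ (c i)⁻¹‖) * ‖M‖ := by ring
        _ ≤ C * ‖M‖ := mul_le_mul_of_nonneg_right (hC i) (norm_nonneg _)
        _ < C * (ε / C) := by gcongr
        _ = ε := by field_simp
    refine ⟨fun i => c i * a * (c i)⁻¹, ?_⟩
    rintro i (_ | _)
    · refine ⟨b', ?_⟩
      convert key i _ hab.2 using 2
      simp [q, mul_sub, sub_mul, mul_assoc]
    · refine ⟨b, ?_⟩
      convert key i _ hab.1 using 2
      simp [q, mul_sub, sub_mul, mul_assoc]


open Cardinal in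
theorem ext_iso {R : Type} [CommRing R] [IsDomain R] (hR : #R ≤ ℵ₀) {K L : Type} [Field K] [Field L]
    [IsAlgClosed K] [IsAlgClosed L] (hK : #K = 𝔠) (hL : #L = 𝔠)
    (i : R →+* K) (hi : Function.Injective i) (j : R →+* L) (hj : Function.Injective j) :
    ∃ σ : K ≃+* L, ∀ r, σ (i r) = j r := by
  letI := i.toAlgebra
  letI := j.toAlgebra
  haveI : FaithfulSMul R K := (faithfulSMul_iff_algebraMap_injective R K).2 hi
  haveI : FaithfulSMul R L := (faithfulSMul_iff_algebraMap_injective R L).2 hj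
  obtain ⟨s, hs⟩ := exists_isTranscendenceBasis R K
  obtain ⟨t, ht⟩ := exists_isTranscendenceBasis R L
  have h1 := IsAlgClosed.cardinal_eq_cardinal_transcendence_basis_of_aleph0_lt' _ hs hR (hK ▸ aleph0_lt_continuum)
  have h2 := IsAlgClosed.cardinal_eq_cardinal_transcendence_basis_of_aleph0_lt' _ ht hR (hL ▸ aleph0_lt_continuum)
  have : #s = #t := by rw [← h1, ← h2, hK, hL]
  obtain ⟨e⟩ := Cardinal.eq.1 this
  letI := IsAlgClosed.isAlgClosure_of_transcendence_basis _ hs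
  letI := IsAlgClosed.isAlgClosure_of_transcendence_basis _ ht
  let E := hs.1.aevalEquiv.symm.trans ((MvPolynomial.renameEquiv R e).trans ht.1.aevalEquiv)
  refine ⟨IsAlgClosure.equivOfEquiv K L E.toRingEquiv, fun r => ?_⟩
  have := IsAlgClosure.equivOfEquiv_algebraMap K L E.toRingEquiv (algebraMap R _ r)
  rw [← IsScalarTower.algebraMap_apply] at this
  refine this.trans ?_
  change algebraMap _ L (E (algebraMap R _ r)) = _
  rw [AlgEquiv.commutes, ← IsScalarTower.algebraMap_apply]
  rfl

theorem rec_of_proper {K k : Type*} [NontriviallyNormedField K] [ProperSpace K] [NormedField k]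
    [NormedAlgebra K k] [Algebra.IsAlgebraic K k] :
    ∀ F : Finset k, (∀ x ∈ F, ‖x‖ = 1) → ∀ ε : ℝ, 0 < ε → ∀ N : ℕ, ∃ m, N ≤ m ∧
      ∀ x ∈ F, ‖x ^ m - 1‖ < ε := by
  intro F hF ε hε N
  let L := IntermediateField.adjoin K (F : Set k)
  haveI : FiniteDimensional K L := by
    apply IntermediateField.finiteDimensional_adjoin
    intro x _
    exact Algebra.IsIntegral.isIntegral x
  haveI : ProperSpace L := FiniteDimensional.proper K L
  have hmem : ∀ x : F, (x : k) ∈ L := fun x => IntermediateField.subset_adjoin _ _ x.2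
  let u : ℕ → (F → L) := fun m x => ⟨x, hmem x⟩ ^ m
  have hu : ∀ m, u m ∈ Set.pi Set.univ (fun _ : F => Metric.closedBall (0 : L) 1) := by
    intro m x _
    simp only [u, mem_closedBall_zero_iff]
    change ‖((⟨x, hmem x⟩ ^ m : L) : k)‖ ≤ 1
    push_cast
    rw [norm_pow, hF _ x.2, one_pow]
  obtain ⟨a, -, φ, hφ, hlim⟩ := (isCompact_univ_pi (fun _ : F => isCompact_closedBall (0:L) 1)).tendsto_subseq hu
  have hc := hlim.cauchySeq
  rw [Metric.cauchySeq_iff] at hc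
  obtain ⟨M, hM⟩ := hc ε hε
  have hgrow : ∀ j, φ M + j ≤ φ (M + j) := fun j => by
    induction j with
    | zero => simp
    | succ j ih => have := hφ (Nat.lt_succ_self (M + j)); simp only [Nat.succ_eq_add_one, ← add_assoc] at this ⊢; omega
  refine ⟨φ (M + N) - φ M, by have := hgrow N; omega, fun x hx => ?_⟩
  have h := hM (M + N) (by omega) M le_rfl
  have h' := lt_of_le_of_lt (dist_le_pi_dist _ _ (⟨x, hx⟩ : F)) h
  rw [dist_eq_norm] at h'
  change ‖((⟨x, hmem ⟨x, hx⟩⟩ ^ φ (M + N) - ⟨x, hmem ⟨x, hx⟩⟩ ^ φ M : L) : k)‖ < ε at h'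
  push_cast at h'
  have e : x ^ φ (M + N) - x ^ φ M = x ^ φ M * (x ^ (φ (M + N) - φ M) - 1) := by
    rw [mul_sub, ← pow_add, mul_one]; congr 2; have := hgrow N; omega
  rw [e, norm_mul, norm_pow, hF x hx, one_pow, one_mul] at h'
  exact h'

open Cardinal in
theorem card_padicAlgCl (p : ℕ) [Fact p.Prime] : #(PadicAlgCl p) = 𝔠 := by
  have h1 : #ℚ_[p] ≤ 𝔠 := by
    have : #ℚ_[p] ≤ #(CauSeq ℚ (padicNorm p)) := mk_le_of_surjective (f := Quotient.mk _) Quotient.mk_surjective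
    refine this.trans ?_
    have h2 : #(CauSeq ℚ (padicNorm p)) ≤ #(ℕ → ℚ) := mk_subtype_le _
    refine h2.trans ?_
    simp
  apply le_antisymm
  · have := Algebra.IsAlgebraic.cardinalMk_le_max ℚ_[p] (PadicAlgCl p)
    exact this.trans (max_le h1 aleph0_le_continuum)
  · have h3 : 𝔠 ≤ #ℚ_[p] := continuum_le_cardinal_of_nontriviallyNormedField _
    exact h3.trans (mk_le_of_injective (algebraMap ℚ_[p] (PadicAlgCl p)).injective)


open Polynomial in
theorem coeff_le_one_of_roots {k : Type*} [NormedField k] [IsUltrametricDist k] (s : Multiset k)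
    (hs : ∀ a ∈ s, ‖a‖ ≤ 1) (n : ℕ) : ‖((s.map (fun a => X - C a)).prod).coeff n‖ ≤ 1 := by
  induction s using Multiset.induction_on generalizing n with
  | empty => 
    simp only [Multiset.map_zero, Multiset.prod_zero, coeff_one]
    split_ifs <;> simp
  | cons a s ih =>
    have ih := ih (fun b hb => hs b (Multiset.mem_cons_of_mem hb))
    have ha := hs a (Multiset.mem_cons_self a s)
    rw [Multiset.map_cons, Multiset.prod_cons, sub_mul, coeff_sub, coeff_C_mul]
    have h2 : ‖a * ((s.map (fun a => X - C a)).prod).coeff n‖ ≤ 1 := by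
      rw [norm_mul]; exact mul_le_one₀ ha (norm_nonneg _) (ih n)
    rw [sub_eq_add_neg]
    refine (IsUltrametricDist.norm_add_le_max _ _).trans (max_le ?_ (by rwa [norm_neg]))
    cases n with
    | zero => simp
    | succ n => rw [coeff_X_mul]; exact ih n

open Cardinal Polynomial in
theorem card_QX : #ℚ[X] ≤ ℵ₀ := by
  simpa using Polynomial.cardinalMk_le_max (R := ℚ)

open Cardinal Polynomial in
theorem exists_place (z : ℂ) (h0 : z ≠ 0) (hroot : ∀ n : ℕ, 0 < n → z ^ n ≠ 1) :
    ∃ (k : Type) (_ : NormedField k) (σ : ℂ ≃+* k), ‖σ z‖ ≠ 1 ∧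
      (∀ F : Finset k, (∀ x ∈ F, ‖x‖ = 1) → ∀ ε : ℝ, 0 < ε → ∀ N : ℕ, ∃ m, N ≤ m ∧
      ∀ x ∈ F, ‖x ^ m - 1‖ < ε) := by
  have hC : #ℂ = 𝔠 := Cardinal.mk_complex
  have recC := rec_of_proper (K := ℂ) (k := ℂ)
  by_cases h1 : ‖z‖ = 1
  swap
  · exact ⟨ℂ, inferInstance, RingEquiv.refl ℂ, h1, recC⟩
  by_cases halg : IsAlgebraic ℚ z
  swap
  · have htr : Transcendental ℚ z := halg
    have htr2 : Transcendental ℚ (2 * z) := by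
      intro h
      apply halg
      have : z = (algebraMap ℚ ℂ (1/2)) * (2 * z) := by simp
      rw [this]
      exact (isAlgebraic_algebraMap _).mul h
    obtain ⟨σ, hσ⟩ := ext_iso (R := ℚ[X]) (by
        exact card_QX) hC hC
      (aeval z : ℚ[X] →ₐ[ℚ] ℂ).toRingHom (transcendental_iff_injective.1 htr)
      (aeval (2 * z) : ℚ[X] →ₐ[ℚ] ℂ).toRingHom (transcendental_iff_injective.1 htr2)
    have := hσ X
    simp at this
    refine ⟨ℂ, inferInstance, σ, ?_, recC⟩
    rw [this, norm_mul, h1]; norm_num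
  have hIntg : IsIntegral ℚ z := halg.isIntegral
  set q := minpoly ℚ z with hq
  haveI : Fact (Irreducible q) := ⟨minpoly.irreducible hIntg⟩
  have hmon : q.Monic := minpoly.monic hIntg
  let i : AdjoinRoot q →+* ℂ := AdjoinRoot.lift (algebraMap ℚ ℂ) z (by
    rw [← aeval_def]; exact minpoly.aeval ℚ z)
  have hiz : i (AdjoinRoot.root q) = z := AdjoinRoot.lift_root _
  have hR : #(AdjoinRoot q) ≤ ℵ₀ := by
    refine (mk_le_of_surjective (f := AdjoinRoot.mk q) AdjoinRoot.mk_surjective).trans ?_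
    exact card_QX
  by_cases hZ : IsIntegral ℤ z
  · haveI : FiniteDimensional ℚ (AdjoinRoot q) := hmon.finite_adjoinRoot
    haveI : NumberField (AdjoinRoot q) := {
      to_charZero := charZero_of_injective_algebraMap (algebraMap ℚ (AdjoinRoot q)).injective
      to_finiteDimensional := by convert this }
    have hZ' : IsIntegral ℤ (AdjoinRoot.root q) := by
      rw [← hiz] at hZ
      exact (isIntegral_algHom_iff i.toIntAlgHom i.injective).1 hZ
    have : ∃ φ : AdjoinRoot q →+* ℂ, ‖φ (AdjoinRoot.root q)‖ ≠ 1 := by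
      by_contra! hcon
      obtain ⟨n, hn, h⟩ := NumberField.Embeddings.pow_eq_one_of_norm_eq_one (AdjoinRoot q) ℂ hZ' hcon
      apply hroot n hn
      rw [← hiz, ← map_pow, h, map_one]
    obtain ⟨φ, hφ⟩ := this
    obtain ⟨σ, hσ⟩ := ext_iso hR hC hC i i.injective φ φ.injective
    refine ⟨ℂ, inferInstance, σ, ?_, recC⟩
    rw [← hiz, hσ]; exact hφ
  · have : ∃ n, (q.coeff n).den ≠ 1 := by
      by_contra! hcon
      apply hZ
      have hl : q ∈ lifts (algebraMap ℤ ℚ) := by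
        rw [lifts_iff_coeff_lifts]
        intro n
        exact ⟨(q.coeff n).num, by
          simpa using (Rat.den_eq_one_iff _).1 (hcon n)⟩
      obtain ⟨Q, hQ, -, hQm⟩ := lifts_and_natDegree_eq_and_monic hl hmon
      refine ⟨Q, hQm, ?_⟩
      have := minpoly.aeval ℚ z
      rw [← hq, ← hQ, aeval_map_algebraMap] at this
      exact this
    obtain ⟨n, hn⟩ := this
    obtain ⟨p, hp, hpd⟩ := Nat.exists_prime_and_dvd hn
    haveI : Fact p.Prime := ⟨hp⟩
    have hbig : 1 < ‖((q.coeff n : ℚ) : ℚ_[p])‖ := by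
      by_contra! hle
      have := (Padic.norm_rat_le_one_iff_padicValuation_le_one p).1 hle
      exact (Rat.padicValuation_le_one_iff.1 this) hpd
    have hspl : ((q.map (algebraMap ℚ (PadicAlgCl p)))).Splits := IsAlgClosed.splits _
    have : ∃ a ∈ (q.map (algebraMap ℚ (PadicAlgCl p))).roots, 1 < ‖a‖ := by
      by_contra! hcon
      have h2 := coeff_le_one_of_roots _ hcon n
      rw [← hspl.eq_prod_roots_of_monic (hmon.map _), coeff_map] at h2
      have h3 := PadicAlgCl.norm_extends p ((q.coeff n : ℚ) : ℚ_[p])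
      simp at h2 h3 hbig
      linarith
    obtain ⟨a, ha, ha1⟩ := this
    let φ : AdjoinRoot q →+* PadicAlgCl p := AdjoinRoot.lift (algebraMap ℚ _) a (by
      rw [← eval_map]; exact (mem_roots'.1 ha).2)
    have hφ : φ (AdjoinRoot.root q) = a := AdjoinRoot.lift_root _
    obtain ⟨σ, hσ⟩ := ext_iso hR hC (card_padicAlgCl p) i i.injective φ φ.injective
    refine ⟨PadicAlgCl p, inferInstance, σ, ?_, rec_of_proper (K := ℚ_[p])⟩
    rw [← hiz, hσ, hφ]; exact ha1.ne'


def transHom {G : Type*} [Group G] (A : Subalgebra ℂ (G → ℂ))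
    (hA : ∀ (h : G) (f : G → ℂ), f ∈ A → (fun γ => f (h * γ)) ∈ A) (h : G) : A →+* A where
  toFun f := ⟨fun γ => f.1 (h * γ), hA h f.1 f.2⟩
  map_one' := rfl
  map_mul' _ _ := rfl
  map_zero' := rfl
  map_add' _ _ := rfl

def vanIdeal {G : Type*} [Group G] (A : Subalgebra ℂ (G → ℂ)) (H : Subgroup G) : Ideal A where
  carrier := {f | ∀ h ∈ H, f.1 h = 0}
  add_mem' := by
    intro a b ha hb h hh
    have e : (a + b).1 h = a.1 h + b.1 h := rfl
    rw [e, ha h hh, hb h hh, add_zero]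
  zero_mem' := fun _ _ => rfl
  smul_mem' := by
    intro c a ha h hh
    have e : (c • a).1 h = c.1 h * a.1 h := rfl
    rw [e, ha h hh, mul_zero]

theorem zariski_connected {G : Type*} [Group G] (A : Subalgebra ℂ (G → ℂ)) [IsNoetherianRing A]
    (hA : ∀ (h : G) (f : G → ℂ), f ∈ A → (fun γ => f (h * γ)) ∈ A) :
    ∃ H0 : Subgroup G, H0.FiniteIndex ∧ ∀ f ∈ A, ∀ g ∈ A, (∀ h ∈ H0, f h * g h = 0) →
      (∀ h ∈ H0, f h = 0) ∨ (∀ h ∈ H0, g h = 0) := by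
  obtain ⟨I0, ⟨H0, hH0, rfl⟩, hmax⟩ := set_has_maximal_iff_noetherian.2
    (inferInstance : IsNoetherian A A) {I | ∃ H : Subgroup G, H.FiniteIndex ∧ I = vanIdeal A H}
    ⟨_, ⊤, inferInstance, rfl⟩
  let ev : A →+* ℂ := (Pi.evalRingHom (fun _ : G => ℂ) 1).comp A.val.toRingHom
  have hev : ∀ f : A, ev f = f.1 1 := fun f => rfl
  haveI : (RingHom.ker ev).IsPrime := RingHom.ker_isPrime ev
  obtain ⟨P, hP, hPle⟩ := Ideal.exists_minimalPrimes_le (I := vanIdeal A H0) (J := RingHom.ker ev) (by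
    intro f hf
    exact hf 1 H0.one_mem)
  letI act : MulAction G (Ideal A) :=
    { smul := fun g Q => Q.comap (transHom A hA g)
      one_smul := by
        intro Q
        ext f
        change (⟨fun γ => f.1 (1 * γ), _⟩ : A) ∈ Q ↔ f ∈ Q
        simp only [one_mul]
      mul_smul := by
        intro a b Q
        ext f
        change (⟨fun γ => f.1 (a * b * γ), _⟩ : A) ∈ Q ↔ (⟨fun γ => f.1 (a * (b * γ)), _⟩ : A) ∈ Q
        simp only [mul_assoc] }
  have smul_def : ∀ (g : G) (Q : Ideal A) (f : A), f ∈ g • Q ↔ transHom A hA g f ∈ Q := fun _ _ _ => Iff.rfl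
  have smul_mono : ∀ (g : G) (Q Q' : Ideal A), Q ≤ Q' → g • Q ≤ g • Q' := by
    intro g Q Q' h f hf
    exact h hf
  have smul_I : ∀ g ∈ H0, vanIdeal A H0 ≤ g • vanIdeal A H0 := by
    intro g hg f hf h hh
    exact hf (g * h) (H0.mul_mem hg hh)
  have smul_prime : ∀ (g : G) (Q : Ideal A), Q.IsPrime → (g • Q).IsPrime := by
    intro g Q hQ
    exact Ideal.IsPrime.comap (transHom A hA g)
  have smul_min : ∀ g ∈ H0, g • P ∈ (vanIdeal A H0).minimalPrimes := by
    intro g hg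
    refine ⟨⟨smul_prime g P hP.1.1, (smul_I g hg).trans (smul_mono g _ _ hP.1.2)⟩, ?_⟩
    intro Q hQ hle
    have h1 : g⁻¹ • Q ≤ P := by
      have := smul_mono g⁻¹ _ _ hle
      rwa [inv_smul_smul] at this
    have h2 := hP.2 ⟨smul_prime g⁻¹ Q hQ.1, (smul_I _ (H0.inv_mem hg)).trans (smul_mono _ _ _ hQ.2)⟩ h1
    have := smul_mono g _ _ h2
    rwa [smul_inv_smul] at this
  have hfin : (MulAction.orbit H0 P).Finite := by
    refine (Ideal.finite_minimalPrimes_of_isNoetherianRing A (vanIdeal A H0)).subset ?_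
    rintro _ ⟨g, rfl⟩
    exact smul_min g.1 g.2
  let K : Subgroup G := (MulAction.stabilizer H0 P).map H0.subtype
  have hK : K.FiniteIndex := by
    haveI : (MulAction.stabilizer H0 P).FiniteIndex := by
      constructor
      rw [MulAction.index_stabilizer]
      exact ((Set.ncard_pos hfin).2 (MulAction.nonempty_orbit P)).ne'
    constructor
    rw [Subgroup.index_map_subtype]
    exact mul_ne_zero Subgroup.FiniteIndex.index_ne_zero hH0.index_ne_zero
  have hKH : K ≤ H0 := Subgroup.map_subtype_le _
  have hPK : P ≤ vanIdeal A K := by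
    rintro f hf _ ⟨k, hk, rfl⟩
    have hk' : (k : G) • P = P := hk
    rw [← hk'] at hf
    have := hPle hf
    have h2 : f.1 (k * 1) = 0 := this
    simpa using h2
  have hIK : vanIdeal A H0 ≤ vanIdeal A K := fun f hf h hh => hf h (hKH hh)
  have heq : vanIdeal A H0 = vanIdeal A K := by
    by_contra hne
    exact hmax _ ⟨K, hK, rfl⟩ (lt_of_le_of_ne hIK hne)
  have hPI : vanIdeal A H0 = P := le_antisymm hP.1.2 (hPK.trans heq.ge)
  refine ⟨H0, hH0, fun f hf g hg hfg => ?_⟩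
  have hp : (vanIdeal A H0).IsPrime := hPI ▸ hP.1.1
  exact hp.mem_or_mem (x := ⟨f, hf⟩) (y := ⟨g, hg⟩) hfg


theorem conn_matrix {G n : Type*} [Group G] [Fintype n] [DecidableEq n] (ρ : G →* Matrix n n ℂ) :
    ∃ (A : Subalgebra ℂ (G → ℂ)) (H0 : Subgroup G), H0.FiniteIndex ∧
      (∀ i j, (fun γ => ρ γ i j) ∈ A) ∧ (∀ i j, (fun γ => ρ γ⁻¹ i j) ∈ A) ∧
      ∀ f ∈ A, ∀ g ∈ A, (∀ h ∈ H0, f h * g h = 0) →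
      (∀ h ∈ H0, f h = 0) ∨ (∀ h ∈ H0, g h = 0) := by
  let s : Set (G → ℂ) := (Set.range fun p : n × n => fun γ => ρ γ p.1 p.2) ∪
    (Set.range fun p : n × n => fun γ => ρ γ⁻¹ p.1 p.2)
  have hs : s.Finite := (Set.finite_range _).union (Set.finite_range _)
  let A := Algebra.adjoin ℂ s
  have h1 : ∀ i j, (fun γ => ρ γ i j) ∈ A := fun i j =>
    Algebra.subset_adjoin (Or.inl ⟨(i, j), rfl⟩)
  have h2 : ∀ i j, (fun γ => ρ γ⁻¹ i j) ∈ A := fun i j =>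
    Algebra.subset_adjoin (Or.inr ⟨(i, j), rfl⟩)
  haveI : Algebra.FiniteType ℂ A := by
    rw [← Subalgebra.fg_iff_finiteType]
    exact Subalgebra.fg_def.mpr ⟨s, hs, rfl⟩
  haveI : IsNoetherianRing A := Algebra.FiniteType.isNoetherianRing ℂ A
  have htr : ∀ (h : G) (f : G → ℂ), f ∈ A → (fun γ => f (h * γ)) ∈ A := by
    intro h f hf
    induction hf using Algebra.adjoin_induction with
    | mem x hx =>
      rcases hx with ⟨⟨i, j⟩, rfl⟩ | ⟨⟨i, j⟩, rfl⟩
      · have : (fun γ => ρ (h * γ) i j) = ∑ k, (ρ h i k) • (fun γ => ρ γ k j) := by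
          ext γ
          simp [Matrix.mul_apply]
        simp only [this]
        exact A.sum_mem fun k _ => A.smul_mem (h1 k j) _
      · have : (fun γ => ρ (h * γ)⁻¹ i j) = ∑ k, (ρ h⁻¹ k j) • (fun γ => ρ γ⁻¹ i k) := by
          ext γ
          simp [Matrix.mul_apply, mul_comm]
        simp only [this]
        exact A.sum_mem fun k _ => A.smul_mem (h2 i k) _
    | algebraMap r => exact A.algebraMap_mem r
    | add x y _ _ hx hy => exact A.add_mem hx hy
    | mul x y _ _ hx hy => exact A.mul_mem hx hy
  obtain ⟨H0, hf, hH⟩ := zariski_connected A htr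
  exact ⟨A, H0, hf, h1, h2, hH⟩

theorem conn_family {G : Type*} [Group G] (A : Subalgebra ℂ (G → ℂ)) (H0 : Subgroup G)
    (hp : ∀ f ∈ A, ∀ g ∈ A, (∀ h ∈ H0, f h * g h = 0) →
      (∀ h ∈ H0, f h = 0) ∨ (∀ h ∈ H0, g h = 0)) (F : Finset (G → ℂ)) (hF : ∀ f ∈ F, f ∈ A)
    (hne : ∀ f ∈ F, ∃ h ∈ H0, f h ≠ 0) : ∃ h ∈ H0, ∀ f ∈ F, f h ≠ 0 := by
  classical
  have : ∃ h ∈ H0, (∏ f ∈ F, f) h ≠ 0 := by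
    induction F using Finset.induction_on with
    | empty => exact ⟨1, H0.one_mem, by simp⟩
    | insert a s ha ih =>
      by_contra! hcon
      rw [Finset.prod_insert ha] at hcon
      rcases hp a (hF a (Finset.mem_insert_self _ _)) _
        (A.prod_mem fun f hf => hF f (Finset.mem_insert_of_mem hf)) hcon with h | h
      · obtain ⟨x, hx, hx'⟩ := hne a (Finset.mem_insert_self _ _)
        exact hx' (h x hx)
      · obtain ⟨x, hx, hx'⟩ := ih (fun f hf => hF f (Finset.mem_insert_of_mem hf))
          (fun f hf => hne f (Finset.mem_insert_of_mem hf))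
        exact hx' (h x hx)
  obtain ⟨h, hh, hn⟩ := this
  rw [Finset.prod_apply, Finset.prod_ne_zero_iff] at hn
  exact ⟨h, hh, hn⟩

theorem conn_const {G : Type*} [Group G] (A : Subalgebra ℂ (G → ℂ)) (H0 : Subgroup G)
    (hp : ∀ f ∈ A, ∀ g ∈ A, (∀ h ∈ H0, f h * g h = 0) →
      (∀ h ∈ H0, f h = 0) ∨ (∀ h ∈ H0, g h = 0)) (f : G → ℂ) (hf : f ∈ A) (s : Set ℂ)
    (hs : s.Finite) (hfs : ∀ h ∈ H0, f h ∈ s) : ∀ h ∈ H0, f h = f 1 := by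
  classical
  by_contra hcon
  have hnc : ∀ c : ℂ, ∃ h ∈ H0, f h ≠ c := by
    intro c
    by_contra! hc
    apply hcon
    intro h hh
    rw [hc h hh, hc 1 H0.one_mem]
  obtain ⟨h, hh, hF⟩ := conn_family A H0 hp (hs.toFinset.image (fun c γ => f γ - c))
    (by
      intro g hg
      obtain ⟨c, -, rfl⟩ := Finset.mem_image.1 hg
      exact A.sub_mem hf (A.algebraMap_mem c))
    (by
      intro g hg
      obtain ⟨c, -, rfl⟩ := Finset.mem_image.1 hg
      obtain ⟨h, hh, hc⟩ := hnc c
      exact ⟨h, hh, sub_ne_zero.2 hc⟩)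
  exact hF _ (Finset.mem_image.2 ⟨f h, by simpa using hfs h hh, rfl⟩) (sub_self _)


open Polynomial in
theorem tot_bound_field0 {L E : Type*} [Field L] [Field E] [CharZero L] [CharZero E] [FiniteDimensional ℚ L]
    [Algebra L E] [FiniteDimensional L E] (z : E) (N : ℕ) (hN : 0 < N) (hz : IsPrimitiveRoot z N) :
    N.totient ≤ Module.finrank ℚ L * Module.finrank L E := by
  haveI : FiniteDimensional ℚ E := FiniteDimensional.trans ℚ L E
  have h2 := minpoly.natDegree_le (A := ℚ) z
  rw [← cyclotomic_eq_minpoly_rat hz hN, natDegree_cyclotomic] at h2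
  rwa [Module.finrank_mul_finrank ℚ L E]

open Polynomial in
theorem tot_bound_field {L L' : Type*} [Field L] [Field L'] [CharZero L] [FiniteDimensional ℚ L]
    [Algebra L L'] (z : L') (N : ℕ) (hN : 0 < N) (hz : (cyclotomic N L').IsRoot z) (p : L[X]) (hp : p.Monic)
    (hpz : aeval z p = 0) : N.totient ≤ Module.finrank ℚ L * p.natDegree := by
  haveI : CharZero L' := charZero_of_injective_algebraMap (algebraMap L L').injective
  haveI : NeZero (N : L') := ⟨by exact_mod_cast hN.ne'⟩
  have hIntg : IsIntegral L z := ⟨p, hp, hpz⟩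
  have hprim : IsPrimitiveRoot z N := isRoot_cyclotomic_iff.1 hz
  haveI : FiniteDimensional L (IntermediateField.adjoin L {z}) := IntermediateField.adjoin.finiteDimensional hIntg
  haveI : CharZero (IntermediateField.adjoin L {z}) :=
    charZero_of_injective_algebraMap (algebraMap L (IntermediateField.adjoin L {z})).injective
  have h1 : Module.finrank L (IntermediateField.adjoin L {z}) ≤ p.natDegree := by
    rw [IntermediateField.adjoin.finrank hIntg]
    exact natDegree_le_of_dvd (minpoly.dvd L z hpz) hp.ne_zero
  have h2 := tot_bound_field0 (L := L) (IntermediateField.AdjoinSimple.gen L z) N hN (by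
    apply IsPrimitiveRoot.of_map_of_injective (f := algebraMap (IntermediateField.adjoin L {z}) L') _
      (algebraMap (IntermediateField.adjoin L {z}) L').injective
    rwa [IntermediateField.AdjoinSimple.algebraMap_gen])
  exact h2.trans (Nat.mul_le_mul_left _ h1)

theorem finite_rat_alg {L : Type*} [Field L] [CharZero L] (a : Algebra ℚ L)
    (h : @Module.Finite ℚ L _ _ a.toModule) :
    @Module.Finite ℚ L _ _ (DivisionRing.toRatAlgebra : Algebra ℚ L).toModule := by
  have e : a = DivisionRing.toRatAlgebra := Subsingleton.elim _ _
  subst e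
  exact h

open Polynomial in
theorem tot_bound_ring (R : Subalgebra ℚ ℂ) (hR : R.FG) : ∃ D : ℕ, ∀ (p : R[X]), p.Monic → ∀ (z : ℂ) (N : ℕ),
    0 < N → IsPrimitiveRoot z N → aeval z p = 0 → N.totient ≤ D * p.natDegree := by
  haveI : Algebra.FiniteType ℚ R := R.fg_iff_finiteType.1 hR
  obtain ⟨m, hm⟩ := Ideal.exists_maximal R
  let _ : Field (R ⧸ m) := Ideal.Quotient.field m
  haveI : Algebra.FiniteType ℚ (R ⧸ m) := inferInstance
  have hfin0 : Module.Finite ℚ (R ⧸ m) := finite_of_finite_type_of_isJacobsonRing ℚ (R ⧸ m)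
  haveI : CharZero (R ⧸ m) := charZero_of_injective_algebraMap (algebraMap ℚ (R ⧸ m)).injective
  have hfin : @Module.Finite ℚ (R ⧸ m) _ _ (DivisionRing.toRatAlgebra : Algebra ℚ (R ⧸ m)).toModule := by
    exact finite_rat_alg (Ideal.Quotient.algebra ℚ) hfin0
  refine ⟨@Module.finrank ℚ (R ⧸ m) _ _ (DivisionRing.toRatAlgebra : Algebra ℚ (R ⧸ m)).toModule, fun p hp z N hN hz hpz => ?_⟩
  let S := Algebra.adjoin R {z}
  have hzint : IsIntegral R z := ⟨p, hp, hpz⟩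
  haveI : Algebra.IsIntegral R S := by
    refine ⟨fun x => ?_⟩
    have hx : IsIntegral R (x : ℂ) := IsIntegral.of_mem_of_fg S hzint.fg_adjoin_singleton x x.2
    exact (isIntegral_algHom_iff S.val Subtype.val_injective).1 hx
  obtain ⟨n, hn, hnm⟩ := Ideal.exists_ideal_over_maximal_of_isIntegral (S := S) m (by
    have hinj : Function.Injective (algebraMap R S) := by
      intro a b hab
      apply Subtype.val_injective
      exact congrArg (fun x : S => (x : ℂ)) hab
    rw [(RingHom.injective_iff_ker_eq_bot _).1 hinj]
    exact bot_le)
  let _ : Field (S ⧸ n) := Ideal.Quotient.field n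
  let _ : Algebra (R ⧸ m) (S ⧸ n) := (Ideal.quotientMap n (algebraMap R S) hnm.ge).toAlgebra
  let zS : S := ⟨z, Algebra.self_mem_adjoin_singleton R z⟩
  have hcomp : (algebraMap (R ⧸ m) (S ⧸ n)).comp (Ideal.Quotient.mk m) =
      (Ideal.Quotient.mk n).comp (algebraMap R S) := by
    ext r; rfl
  have := tot_bound_field (L := R ⧸ m) (L' := S ⧸ n) (Ideal.Quotient.mk n zS) N hN (by
      have h1 : (cyclotomic N S).IsRoot zS := by
        have h2 : (cyclotomic N ℂ).IsRoot z := hz.isRoot_cyclotomic hN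
        rw [IsRoot.def, ← map_cyclotomic N (algebraMap S ℂ), eval_map,
          show z = algebraMap S ℂ zS from rfl, eval₂_at_apply] at h2
        exact Subtype.val_injective h2
      rw [IsRoot.def, ← map_cyclotomic N (Ideal.Quotient.mk n), eval_map, eval₂_at_apply, h1.eq_zero, map_zero])
    (p.map (Ideal.Quotient.mk m)) (hp.map _) (by
      rw [aeval_def, eval₂_map, hcomp, ← hom_eval₂]
      have : eval₂ (algebraMap R S) zS p = 0 := by
        apply Subtype.val_injective
        have : (algebraMap S ℂ) (eval₂ (algebraMap R S) zS p) = 0 := by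
          rw [hom_eval₂]; exact hpz
        exact this
      rw [this, map_zero])
  rwa [hp.natDegree_map] at this

theorem dvd_factorial_of_totient {N D : ℕ} (hN : 0 < N) (h : N.totient ≤ D) : N ∣ (2 * D).factorial := by
  rw [Nat.dvd_iff_prime_pow_dvd_dvd]
  intro p k hp hk
  apply Nat.dvd_factorial (pow_pos hp.pos _)
  rcases Nat.eq_zero_or_pos k with rfl | hk0
  · have := Nat.totient_pos.2 hN
    simp; omega
  have h1 : (p ^ k).totient ≤ N.totient := Nat.le_of_dvd (Nat.totient_pos.2 hN) (Nat.totient_dvd_of_dvd hk)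
  rw [Nat.totient_prime_pow hp hk0] at h1
  obtain ⟨j, rfl⟩ : ∃ j, k = j + 1 := ⟨k - 1, by omega⟩
  have h2 := hp.two_le
  obtain ⟨q, rfl⟩ : ∃ q, p = q + 1 := ⟨p - 1, by omega⟩
  simp at h1
  rw [pow_succ]
  have : (q + 1) ^ j * (q + 1) ≤ 2 * ((q + 1) ^ j * q) := by
    have := Nat.zero_le ((q + 1) ^ j)
    nlinarith
  omega

open Polynomial in
theorem ratio_bound {G n : Type*} [Group G] [Group.FG G] [Fintype n] [DecidableEq n] (ρ : G →* Matrix n n ℂ) :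
    ∃ M : ℕ, 0 < M ∧ ∀ (γ : G) (v w : n → ℂ) (x y : ℂ), v ≠ 0 → w ≠ 0 → Matrix.mulVec (ρ γ) v = x • v →
      Matrix.mulVec (ρ γ) w = y • w → (∃ N : ℕ, 0 < N ∧ (x / y) ^ N = 1) → (x / y) ^ M = 1 := by
  obtain ⟨s, hs⟩ := Group.fg_def.1 (inferInstance : Group.FG G)
  let T : Set ℂ := ⋃ g ∈ s, ⋃ p : n × n, {ρ g p.1 p.2, ρ g⁻¹ p.1 p.2}
  have hT : T.Finite := by
    refine Set.Finite.biUnion s.finite_toSet fun g _ => Set.finite_iUnion fun p => by simp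
  let R := Algebra.adjoin ℚ T
  have hR : R.FG := Subalgebra.fg_def.2 ⟨T, hT, rfl⟩
  obtain ⟨D, hD⟩ := tot_bound_ring R hR
  have hmem : ∀ γ : G, (∀ i j, ρ γ i j ∈ R) ∧ (∀ i j, ρ γ⁻¹ i j ∈ R) := by
    intro γ
    have hγ : γ ∈ Subgroup.closure (s : Set G) := by rw [hs]; trivial
    induction hγ using Subgroup.closure_induction with
    | mem g hg =>
      constructor <;> intro i j <;> apply Algebra.subset_adjoin <;> simp only [T, Set.mem_iUnion] <;>
        refine ⟨g, hg, (i, j), by simp⟩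
    | one =>
      constructor <;> intro i j <;> simp only [inv_one, map_one, Matrix.one_apply] <;> split_ifs
      exacts [R.one_mem, R.zero_mem, R.one_mem, R.zero_mem]
    | mul a b _ _ ha hb =>
      constructor <;> intro i j <;> simp only [mul_inv_rev, map_mul, Matrix.mul_apply]
      · exact R.sum_mem fun k _ => R.mul_mem (ha.1 _ _) (hb.1 _ _)
      · exact R.sum_mem fun k _ => R.mul_mem (hb.2 _ _) (ha.2 _ _)
    | inv a _ ha => exact ⟨ha.2, by simpa using ha.1⟩
  refine ⟨(2 * (D * Fintype.card (n × n))).factorial, Nat.factorial_pos _, ?_⟩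
  rintro γ v w x y hv hw hx hy ⟨N0, hN0, hxy⟩
  have hinv : Matrix.mulVec (ρ γ⁻¹) w = y⁻¹ • w := by
    have h1 : Matrix.mulVec (ρ γ⁻¹) (Matrix.mulVec (ρ γ) w) = w := by
      rw [Matrix.mulVec_mulVec, ← map_mul]; simp
    rw [hy, Matrix.mulVec_smul] at h1
    have hy0 : y ≠ 0 := by
      rintro rfl
      simp at h1; exact hw h1.symm
    rw [← h1, smul_smul, inv_mul_cancel₀ hy0, one_smul, h1]
  let B : Matrix (n × n) (n × n) ℂ := Matrix.of fun p q => ρ γ p.1 q.1 * ρ γ⁻¹ p.2 q.2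
  let B' : Matrix (n × n) (n × n) R := Matrix.of fun p q =>
    ⟨ρ γ p.1 q.1 * ρ γ⁻¹ p.2 q.2, R.mul_mem ((hmem γ).1 _ _) ((hmem γ).2 _ _)⟩
  have hB : B'.map (algebraMap R ℂ) = B := by ext; rfl
  have hBv : B.mulVec (fun p => v p.1 * w p.2) = (x / y) • (fun p => v p.1 * w p.2) := by
    ext ⟨i, j⟩
    have e1 := congrFun hx i
    have e2 := congrFun hinv j
    simp only [Matrix.mulVec, dotProduct, Pi.smul_apply, smul_eq_mul] at e1 e2 ⊢
    rw [div_eq_mul_inv, show x * y⁻¹ * (v i * w j) = (x * v i) * (y⁻¹ * w j) by ring, ← e1, ← e2,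
      Finset.sum_mul_sum, Fintype.sum_prod_type]
    refine Finset.sum_congr rfl fun a _ => Finset.sum_congr rfl fun b _ => ?_
    simp only [B, Matrix.of_apply]
    ring
  have hne : (fun p : n × n => v p.1 * w p.2) ≠ 0 := by
    obtain ⟨i, hi⟩ := Function.ne_iff.1 hv
    obtain ⟨j, hj⟩ := Function.ne_iff.1 hw
    intro h
    exact mul_ne_zero hi hj (congrFun h (i, j))
  have hroot : B.charpoly.IsRoot (x / y) := by
    rw [IsRoot.def, Matrix.eval_charpoly]
    rw [← Matrix.exists_mulVec_eq_zero_iff]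
    refine ⟨_, hne, ?_⟩
    rw [Matrix.sub_mulVec, hBv]
    simp
  have h1 := hD B'.charpoly B'.charpoly_monic (x / y) (orderOf (x / y))
    (orderOf_pos_iff.2 (isOfFinOrder_iff_pow_eq_one.2 ⟨N0, hN0, hxy⟩)) (IsPrimitiveRoot.orderOf _) (by
      rw [aeval_def, ← eval_map, ← Matrix.charpoly_map, hB]
      exact hroot)
  rw [Matrix.charpoly_natDegree_eq_dim] at h1
  exact orderOf_dvd_iff_pow_eq_one.1 (dvd_factorial_of_totient
    (orderOf_pos_iff.2 (isOfFinOrder_iff_pow_eq_one.2 ⟨N0, hN0, hxy⟩)) h1)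


open Module in
theorem isom_inner {W : Type*} [NormedAddCommGroup W] [InnerProductSpace ℂ W] (T : End ℂ W)
    (hT : ∀ x, ‖T x‖ = ‖x‖) (x y : W) : inner ℂ (T x) (T y) = inner ℂ x y :=
  (LinearMap.norm_map_iff_inner_map_map T).1 hT x y

open Module in
/-- orthogonal complement of an invariant subspace is invariant -/
theorem isom_orth {W : Type*} [NormedAddCommGroup W] [InnerProductSpace ℂ W] [FiniteDimensional ℂ W]
    (T : End ℂ W) (hT : ∀ x, ‖T x‖ = ‖x‖) (U : Submodule ℂ W) (hU : ∀ x ∈ U, T x ∈ U) :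
    ∀ x ∈ Uᗮ, T x ∈ Uᗮ := by
  intro x hx
  rw [Submodule.mem_orthogonal]
  intro u hu
  have hinj : Function.Injective (T.restrict hU) := by
    rw [← LinearMap.ker_eq_bot, LinearMap.ker_eq_bot']
    intro m hm
    have : T m = 0 := congrArg Subtype.val hm
    have h2 := hT m
    rw [this, norm_zero] at h2
    exact Subtype.ext (norm_eq_zero.1 h2.symm)
  obtain ⟨u', hu'⟩ := (LinearMap.injective_iff_surjective.1 hinj) ⟨u, hu⟩
  have e : T u' = u := congrArg Subtype.val hu'
  rw [← e, isom_inner T hT]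
  exact (Submodule.mem_orthogonal _ _).1 hx _ u'.2

open Module in
theorem isom_eigenbasis {W : Type*} [NormedAddCommGroup W] [InnerProductSpace ℂ W] [FiniteDimensional ℂ W]
    (T : End ℂ W) (hT : ∀ x, ‖T x‖ = ‖x‖) :
    ∃ (b : Basis (Fin (finrank ℂ W)) ℂ W) (d : Fin (finrank ℂ W) → ℂ), ∀ i, T (b i) = d i • b i := by
  classical
  let s : Set W := {x | ∃ c : ℂ, T x = c • x}
  let U := Submodule.span ℂ s
  have hU : ∀ x ∈ U, T x ∈ U := by
    intro x hx
    induction hx using Submodule.span_induction with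
    | mem x h =>
      obtain ⟨c, hc⟩ := h
      rw [hc]
      exact U.smul_mem c (Submodule.subset_span ⟨c, hc⟩)
    | zero => simp
    | add x y _ _ hx hy => rw [map_add]; exact U.add_mem hx hy
    | smul a x _ hx => rw [map_smul]; exact U.smul_mem a hx
  have hperp := isom_orth T hT U hU
  have hbot : Uᗮ = ⊥ := by
    by_contra hne
    haveI : Nontrivial Uᗮ := Submodule.nontrivial_iff_ne_bot.2 hne
    obtain ⟨c, hc⟩ := Module.End.exists_eigenvalue (T.restrict hperp)
    obtain ⟨v, hv⟩ := hc.exists_hasEigenvector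
    have h1 : T v = c • (v : W) := congrArg Subtype.val hv.apply_eq_smul
    have h2 : (v : W) ∈ U := Submodule.subset_span ⟨c, h1⟩
    have h3 : (v : W) = 0 := by
      have := (Submodule.mem_orthogonal _ _).1 v.2 v h2
      exact inner_self_eq_zero.1 this
    exact hv.2 (Subtype.ext h3)
  have htop : ⊤ ≤ U := by
    rw [Submodule.orthogonal_eq_bot_iff] at hbot
    exact hbot.ge
  let b0 := Basis.ofSpan htop
  haveI : Fintype _ := FiniteDimensional.fintypeBasisIndex b0
  let e := Fintype.equivFinOfCardEq (finrank_eq_card_basis b0).symm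
  let b := b0.reindex e
  have hb : ∀ i, ∃ c : ℂ, T (b i) = c • b i := by
    intro i
    have : b i ∈ s := by
      apply Basis.ofSpan_subset htop
      rw [Basis.coe_reindex]
      exact ⟨_, rfl⟩
    exact this
  choose d hd using hb
  exact ⟨b, d, hd⟩

open Module in
theorem conn_rep {G V : Type*} [Group G] [AddCommGroup V] [Module ℂ V] [FiniteDimensional ℂ V]
    (ρ : G →* End ℂ V) : ∃ H0 : Subgroup G, H0.FiniteIndex ∧ ∃ A : Subalgebra ℂ (H0 → ℂ),
      (∀ (l : Dual ℂ V) (x : V), (fun γ : H0 => l (ρ γ x)) ∈ A) ∧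
      (∀ (l : Dual ℂ V) (x : V), (fun γ : H0 => l (ρ γ⁻¹ x)) ∈ A) ∧
      (∀ f ∈ A, ∀ g ∈ A, (∀ h, f h * g h = 0) → (∀ h, f h = 0) ∨ (∀ h, g h = 0)) := by
  let b := finBasis ℂ V
  let S : G →* Matrix (Fin (finrank ℂ V)) (Fin (finrank ℂ V)) ℂ :=
    ((LinearMap.toMatrixAlgEquiv b : _ →* Matrix _ _ ℂ)).comp ρ
  have hS : ∀ γ i j, S γ i j = b.coord i (ρ γ (b j)) := fun γ i j => LinearMap.toMatrix_apply _ _ _ _ _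
  obtain ⟨A, H0, hfin, h1, h2, hp⟩ := conn_matrix S
  have key : ∀ (l : Dual ℂ V) (x : V) (T : End ℂ V), l (T x) =
      ∑ j, ∑ i, (b.repr x j * l (b i)) * b.coord i (T (b j)) := by
    intro l x T
    conv_lhs => rw [← b.sum_repr x]
    simp only [map_sum, map_smul]
    refine Finset.sum_congr rfl fun j _ => ?_
    conv_lhs => rw [← b.sum_repr (T (b j))]
    simp only [map_sum, map_smul, smul_eq_mul, Finset.mul_sum, Basis.coord_apply]
    refine Finset.sum_congr rfl fun i _ => ?_
    ring
  let res : (G → ℂ) →ₐ[ℂ] (H0 → ℂ) := AlgHom.pi (fun h => Pi.evalAlgHom ℂ _ h.1)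
  refine ⟨H0, hfin, A.map res, ?_, ?_, ?_⟩
  · intro l x
    refine ⟨fun γ => l (ρ γ x), ?_, rfl⟩
    have : (fun γ => l (ρ γ x)) = ∑ j, ∑ i, (b.repr x j * l (b i)) • (fun γ => S γ i j) := by
      ext γ
      rw [key l x (ρ γ)]
      simp [hS]
    simp only [this]
    exact A.sum_mem fun j _ => A.sum_mem fun i _ => A.smul_mem (h1 i j) _
  · intro l x
    refine ⟨fun γ => l (ρ γ⁻¹ x), ?_, rfl⟩
    have : (fun γ => l (ρ γ⁻¹ x)) = ∑ j, ∑ i, (b.repr x j * l (b i)) • (fun γ => S γ⁻¹ i j) := by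
      ext γ
      rw [key l x (ρ γ⁻¹)]
      simp [hS]
    simp only [this]
    exact A.sum_mem fun j _ => A.sum_mem fun i _ => A.smul_mem (h2 i j) _
  · rintro _ ⟨f, hf, rfl⟩ _ ⟨g, hg, rfl⟩ h
    rcases hp f hf g hg (fun x hx => h ⟨x, hx⟩) with h | h
    · exact Or.inl fun x => h x.1 x.2
    · exact Or.inr fun x => h x.1 x.2


theorem gen_complex {H n : Type*} [Group H] [Fintype n] [DecidableEq n] (S : H →* Matrix n n ℂ)
    (A : Subalgebra ℂ (H → ℂ)) (h1 : ∀ i j, (fun γ => S γ i j) ∈ A)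
    (h2 : ∀ i j, (fun γ => S γ⁻¹ i j) ∈ A)
    (hp : ∀ f ∈ A, ∀ g ∈ A, (∀ h, f h * g h = 0) → (∀ h, f h = 0) ∨ (∀ h, g h = 0))
    (hirr : ∀ X Y : Matrix n n ℂ, X ≠ 0 → Y ≠ 0 → ∃ h, X * S h * Y ≠ 0)
    (F : Finset (Matrix n n ℂ)) (hF : ∀ X ∈ F, X ≠ 0) :
    ∃ h, ∀ X ∈ F, ∀ Y ∈ F, X * S h * Y ≠ 0 ∧ X * S h⁻¹ * Y ≠ 0 := by
  classical
  have hmem : ∀ (X Y : Matrix n n ℂ) (p q : n), (fun γ => (X * S γ * Y) p q) ∈ A := by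
    intro X Y p q
    have : (fun γ => (X * S γ * Y) p q) = ∑ j, ∑ i, (X p i * Y j q) • (fun γ => S γ i j) := by
      ext γ
      simp only [Matrix.mul_apply, Finset.sum_mul, Finset.sum_apply, Pi.smul_apply, smul_eq_mul]
      refine Finset.sum_congr rfl fun j _ => Finset.sum_congr rfl fun i _ => ?_
      ring
    rw [this]
    exact A.sum_mem fun j _ => A.sum_mem fun i _ => A.smul_mem (h1 i j) _
  have hmem' : ∀ (X Y : Matrix n n ℂ) (p q : n), (fun γ => (X * S γ⁻¹ * Y) p q) ∈ A := by
    intro X Y p q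
    have : (fun γ => (X * S γ⁻¹ * Y) p q) = ∑ j, ∑ i, (X p i * Y j q) • (fun γ => S γ⁻¹ i j) := by
      ext γ
      simp only [Matrix.mul_apply, Finset.sum_mul, Finset.sum_apply, Pi.smul_apply, smul_eq_mul]
      refine Finset.sum_congr rfl fun j _ => Finset.sum_congr rfl fun i _ => ?_
      ring
    rw [this]
    exact A.sum_mem fun j _ => A.sum_mem fun i _ => A.smul_mem (h2 i j) _
  have hpick : ∀ P : F × F, ∃ p q : n, ∃ h, (P.1.1 * S h * P.2.1) p q ≠ 0 := by
    intro P
    obtain ⟨h, hh⟩ := hirr P.1.1 P.2.1 (hF _ P.1.2) (hF _ P.2.2)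
    by_contra! hcon
    exact hh (Matrix.ext fun p q => hcon p q h)
  choose p q h0 hpq using hpick
  obtain ⟨h, -, hh⟩ := conn_family A ⊤ (fun f hf g hg hfg => by
      simpa using hp f hf g hg (fun h => hfg h trivial))
    (Finset.univ.image (fun P : F × F => fun γ => (P.1.1 * S γ * P.2.1) (p P) (q P)) ∪
     Finset.univ.image (fun P : F × F => fun γ => (P.1.1 * S γ⁻¹ * P.2.1) (p P) (q P)))
    (by
      intro f hf
      rcases Finset.mem_union.1 hf with hf | hf <;> obtain ⟨P, -, rfl⟩ := Finset.mem_image.1 hf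
      · exact hmem _ _ _ _
      · exact hmem' _ _ _ _)
    (by
      intro f hf
      rcases Finset.mem_union.1 hf with hf | hf <;> obtain ⟨P, -, rfl⟩ := Finset.mem_image.1 hf
      · exact ⟨h0 P, trivial, hpq P⟩
      · exact ⟨(h0 P)⁻¹, trivial, by simpa using hpq P⟩)
  refine ⟨h, fun X hX Y hY => ⟨fun h0 => ?_, fun h0 => ?_⟩⟩
  · have := hh _ (Finset.mem_union_left _ (Finset.mem_image_of_mem _ (Finset.mem_univ (⟨⟨X, hX⟩, ⟨Y, hY⟩⟩ : F × F))))
    apply this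
    simp only [h0, Matrix.zero_apply]
  · have := hh _ (Finset.mem_union_right _ (Finset.mem_image_of_mem _ (Finset.mem_univ (⟨⟨X, hX⟩, ⟨Y, hY⟩⟩ : F × F))))
    apply this
    simp only [h0, Matrix.zero_apply]

open Module in
theorem irr_scalar {H W : Type*} [Group H] [Group.FG H] [NormedAddCommGroup W] [InnerProductSpace ℂ W]
    [FiniteDimensional ℂ W] (σ : H →* End ℂ W) (hσ : ∀ g x, ‖σ g x‖ = ‖x‖)
    (A : Subalgebra ℂ (H → ℂ)) (h1 : ∀ (l : Dual ℂ W) x, (fun γ => l (σ γ x)) ∈ A)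
    (h2 : ∀ (l : Dual ℂ W) x, (fun γ => l (σ γ⁻¹ x)) ∈ A)
    (hp : ∀ f ∈ A, ∀ g ∈ A, (∀ h, f h * g h = 0) → (∀ h, f h = 0) ∨ (∀ h, g h = 0))
    (hirr : ∀ U : Submodule ℂ W, (∀ h, ∀ x ∈ U, σ h x ∈ U) → U = ⊥ ∨ U = ⊤)
    (hfree : ¬ ∃ f : FreeGroup (Fin 2) →* H, Function.Injective f) :
    ∀ g, ∃ c : ℂ, ∀ x, σ g x = c • x := by
  classical
  have hSb : ∀ (b : Basis (Fin (finrank ℂ W)) ℂ W), ∃ S : H →* Matrix (Fin (finrank ℂ W)) (Fin (finrank ℂ W)) ℂ,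
      ∀ γ, S γ = LinearMap.toMatrix b b (σ γ) := fun b =>
    ⟨((LinearMap.toMatrixAlgEquiv b : _ →* Matrix _ _ ℂ)).comp σ, fun γ => rfl⟩
  by_cases hex : ∃ (g : H) (b : Basis (Fin (finrank ℂ W)) ℂ W) (d : Fin (finrank ℂ W) → ℂ) (i j : Fin (finrank ℂ W)),
      (∀ i, σ g (b i) = d i • b i) ∧ ∀ N : ℕ, 0 < N → (d i / d j) ^ N ≠ 1
  · exfalso
    apply hfree
    obtain ⟨g, b, d, i, j, hd, hN⟩ := hex
    obtain ⟨S, hS⟩ := hSb b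
    have hd0 : ∀ i, d i ≠ 0 := by
      intro i h0
      have := hσ g (b i)
      rw [hd, h0, zero_smul, norm_zero] at this
      exact b.ne_zero i (norm_eq_zero.1 this.symm)
    obtain ⟨k, _, τ, hτ, hrec⟩ := exists_place (d i / d j) (div_ne_zero (hd0 i) (hd0 j)) hN
    have hirr' : ∀ X Y : Matrix (Fin (finrank ℂ W)) (Fin (finrank ℂ W)) ℂ, X ≠ 0 → Y ≠ 0 → ∃ h, X * S h * Y ≠ 0 := by
      intro X Y hX hY
      by_contra! hcon
      let x := Matrix.toLin b b X
      let y := Matrix.toLin b b Y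
      have hx : x ≠ 0 := by simpa [x] using hX
      have hy : y ≠ 0 := by simpa [y] using hY
      have hxy : ∀ h w, x (σ h (y w)) = 0 := by
        intro h w
        have h3 : Matrix.toLin b b (X * S h * Y) = 0 := by rw [hcon h, map_zero]
        rw [Matrix.toLin_mul b b b, Matrix.toLin_mul b b b, hS, Matrix.toLin_toMatrix] at h3
        exact LinearMap.congr_fun h3 w
      obtain ⟨w, hw⟩ : ∃ w, y w ≠ 0 := by
        by_contra! hc
        exact hy (LinearMap.ext hc)
      let U := Submodule.span ℂ (Set.range fun h => σ h (y w))
      have hU : ∀ h, ∀ x ∈ U, σ h x ∈ U := by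
        intro h u hu
        induction hu using Submodule.span_induction with
        | mem u hu =>
          obtain ⟨h', rfl⟩ := hu
          refine Submodule.subset_span ⟨h * h', ?_⟩
          simp only [map_mul, Module.End.mul_apply]
        | zero => simp
        | add x y _ _ hx hy => rw [map_add]; exact U.add_mem hx hy
        | smul a x _ hx => rw [map_smul]; exact U.smul_mem a hx
      have hUx : U ≤ LinearMap.ker x := by
        rw [Submodule.span_le]
        rintro _ ⟨h, rfl⟩
        exact hxy h w
      rcases hirr U hU with h | h
      · apply hw
        have : y w ∈ U := Submodule.subset_span ⟨1, by simp⟩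
        rw [h] at this
        exact this
      · rw [h] at hUx
        exact hx (LinearMap.ker_eq_top.1 (top_le_iff.1 hUx))
    have gen := gen_complex S A (fun i j => by
        simp only [hS, LinearMap.toMatrix_apply]
        exact h1 (b.coord i) (b j)) (fun i j => by
        simp only [hS, LinearMap.toMatrix_apply]
        exact h2 (b.coord i) (b j)) hp hirr'
    have hrt : ∀ X : Matrix (Fin (finrank ℂ W)) (Fin (finrank ℂ W)) k,
        τ.toRingHom.mapMatrix (τ.symm.toRingHom.mapMatrix X) = X := by
      intro X
      ext p q
      exact τ.apply_symm_apply _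
    have hrt' : ∀ X : Matrix (Fin (finrank ℂ W)) (Fin (finrank ℂ W)) ℂ,
        τ.toRingHom.mapMatrix X = 0 → X = 0 := by
      intro X hX
      ext p q
      have := congrFun (congrFun hX p) q
      exact τ.injective (by simpa using this)
    refine pp_main (((τ.toRingHom.mapMatrix : Matrix (Fin (finrank ℂ W)) (Fin (finrank ℂ W)) ℂ →+* _) :
      Matrix _ _ ℂ →* Matrix _ _ k).comp S) ?_ hrec g (fun i => τ (d i)) ?_ i j ?_
    · intro F hF
      obtain ⟨h, hh⟩ := gen (F.image τ.symm.toRingHom.mapMatrix) (by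
        intro X hX h0
        obtain ⟨Y, hY, rfl⟩ := Finset.mem_image.1 hX
        apply hF Y hY
        rw [← hrt Y, h0, map_zero])
      refine ⟨h, fun X hX Y hY => ?_⟩
      have h3 := hh _ (Finset.mem_image_of_mem _ hX) _ (Finset.mem_image_of_mem _ hY)
      constructor
      · intro h0
        apply h3.1
        apply hrt'
        rw [map_mul, map_mul, hrt, hrt]
        exact h0
      · intro h0
        apply h3.2
        apply hrt'
        rw [map_mul, map_mul, hrt, hrt]
        exact h0
    · have : S g = Matrix.diagonal d := by
        rw [hS]
        ext p q
        rw [LinearMap.toMatrix_apply, hd, map_smul, Basis.repr_self, Matrix.diagonal_apply]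
        by_cases hpq : p = q
        · subst hpq; simp
        · simp [hpq, Finsupp.single_apply, Ne.symm hpq]
      change τ.toRingHom.mapMatrix (S g) = _
      rw [this]
      ext p q
      by_cases hpq : p = q
      · subst hpq; simp
      · simp [hpq]
    · intro he
      apply hτ
      rw [map_div₀, norm_div, he, div_self]
      rw [norm_ne_zero_iff]
      simpa using hd0 j
  · push Not at hex
    let b0 := finBasis ℂ W
    obtain ⟨S0, hS0⟩ := hSb b0
    obtain ⟨M, hM, hratio⟩ := ratio_bound S0
    have hrat : ∀ (g : H) (b : Basis (Fin (finrank ℂ W)) ℂ W) (d : Fin (finrank ℂ W) → ℂ),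
      (∀ i, σ g (b i) = d i • b i) → ∀ i j, (d i / d j) ^ M = 1 := by
      intro g b d hd i j
      have hv : ∀ i, Matrix.mulVec (S0 g) (b0.repr (b i)) = d i • ⇑(b0.repr (b i)) := by
        intro i
        rw [hS0, LinearMap.toMatrix_mulVec_repr, hd]
        simp
      have hv0 : ∀ i, ⇑(b0.repr (b i)) ≠ 0 := by
        intro i h0
        have : b0.repr (b i) = 0 := DFunLike.coe_injective h0
        exact b.ne_zero i (by simpa using this)
      exact hratio g _ _ (d i) (d j) (hv0 i) (hv0 j) (hv i) (hv j) (hex g b d i j hd)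
    let f : H → ℂ := fun γ => (LinearMap.trace ℂ W (σ γ)) * (LinearMap.trace ℂ W (σ γ⁻¹))
    have hfA : f ∈ A := by
      have t1 : (fun γ => LinearMap.trace ℂ W (σ γ)) ∈ A := by
        have : (fun γ => LinearMap.trace ℂ W (σ γ)) = ∑ i, fun γ => b0.coord i (σ γ (b0 i)) := by
          ext γ
          rw [LinearMap.trace_eq_matrix_trace ℂ b0]
          simp [Matrix.trace, LinearMap.toMatrix_apply]
        rw [this]
        exact A.sum_mem fun i _ => h1 _ _
      have t2 : (fun γ => LinearMap.trace ℂ W (σ γ⁻¹)) ∈ A := by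
        have : (fun γ => LinearMap.trace ℂ W (σ γ⁻¹)) = ∑ i, fun γ => b0.coord i (σ γ⁻¹ (b0 i)) := by
          ext γ
          rw [LinearMap.trace_eq_matrix_trace ℂ b0]
          simp [Matrix.trace, LinearMap.toMatrix_apply]
        rw [this]
        exact A.sum_mem fun i _ => h2 _ _
      exact A.mul_mem t1 t2
    have hfval : ∀ (g : H) (b : Basis (Fin (finrank ℂ W)) ℂ W) (d : Fin (finrank ℂ W) → ℂ),
      (∀ i, σ g (b i) = d i • b i) → f g = ∑ P : Fin (finrank ℂ W) × Fin (finrank ℂ W), d P.1 / d P.2 := by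
      intro g b d hd
      have hinv : ∀ i, σ g⁻¹ (b i) = (d i)⁻¹ • b i := by
        intro i
        have h3 : σ g⁻¹ (σ g (b i)) = b i := by
          rw [← Module.End.mul_apply, ← map_mul]; simp
        rw [hd, map_smul] at h3
        have h0 : d i ≠ 0 := by
          intro h0
          rw [h0, zero_smul] at h3
          exact b.ne_zero i h3.symm
        rw [← h3, smul_smul, inv_mul_cancel₀ h0, one_smul, h3]
      simp only [f]
      rw [LinearMap.trace_eq_matrix_trace ℂ b, LinearMap.trace_eq_matrix_trace ℂ b]
      simp only [Matrix.trace, Matrix.diag_apply, LinearMap.toMatrix_apply, hd, hinv, map_smul, Basis.repr_self]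
      simp only [Finsupp.smul_apply, Finsupp.single_eq_same, smul_eq_mul, mul_one]
      rw [Finset.sum_mul_sum, Fintype.sum_prod_type]
      simp only [div_eq_mul_inv]
    let Z : Set ℂ := {z | z ^ M = 1}
    have hZ : Z.Finite := by
      have : Z ⊆ ((Polynomial.nthRoots M (1:ℂ)).toFinset : Set ℂ) := by
        intro z hz
        simp only [Finset.mem_coe, Multiset.mem_toFinset]
        exact (Polynomial.mem_nthRoots hM).2 hz
      exact (Finset.finite_toSet _).subset this
    haveI : Finite Z := hZ
    have hconst := conn_const A ⊤ (fun f hf g hg hfg => by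
      simpa using hp f hf g hg (fun h => hfg h trivial)) f hfA
      (Set.range fun u : Fin (finrank ℂ W) × Fin (finrank ℂ W) → Z => ∑ P, (u P : ℂ)) (Set.finite_range _)
      (by
        intro g _
        obtain ⟨b, d, hd⟩ := isom_eigenbasis (σ g) (hσ g)
        exact ⟨fun P => ⟨d P.1 / d P.2, hrat g b d hd _ _⟩, (hfval g b d hd).symm⟩)
    intro g
    obtain ⟨b, d, hd⟩ := isom_eigenbasis (σ g) (hσ g)
    have hf1 : f 1 = ∑ P : Fin (finrank ℂ W) × Fin (finrank ℂ W), 1 := by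
      have := hfval 1 b (fun _ => 1) (by simp)
      simpa using this
    have hfg := hconst g trivial
    rw [hf1, hfval g b d hd] at hfg
    have hnorm : ∀ P : Fin (finrank ℂ W) × Fin (finrank ℂ W), ‖d P.1 / d P.2‖ = 1 := fun P =>
      Complex.norm_eq_one_of_pow_eq_one (hrat g b d hd P.1 P.2) hM.ne'
    have hre : ∀ P : Fin (finrank ℂ W) × Fin (finrank ℂ W), (d P.1 / d P.2).re = 1 := by
      have h3 := congrArg Complex.re hfg
      rw [Complex.re_sum, Complex.re_sum] at h3
      have h4 := (Finset.sum_eq_sum_iff_of_le (fun P _ => (Complex.re_le_norm _).trans (hnorm P).le)).1 h3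
      intro P
      simpa using h4 P (Finset.mem_univ P)
    have heq : ∀ i j, d i = d j := by
      intro i j
      have h3 : d i / d j = 1 := by
        have h4 := hnorm (i, j)
        have h5 := hre (i, j)
        have h6 := Complex.sq_norm (d i / d j)
        rw [Complex.normSq_apply] at h6
        simp only at h4 h5
        rw [h4, h5] at h6
        apply Complex.ext
        · simpa using h5
        · simp only [Complex.one_im]; nlinarith
      exact (div_eq_one_iff_eq (by rintro h; rw [h] at h3; simp at h3)).1 h3
    rcases isEmpty_or_nonempty (Fin (finrank ℂ W)) with he | ⟨⟨i0⟩⟩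
    · refine ⟨0, fun x => ?_⟩
      haveI : Subsingleton W := b.repr.toEquiv.subsingleton
      exact Subsingleton.elim _ _
    · refine ⟨d i0, fun x => ?_⟩
      have : σ g = d i0 • (1 : End ℂ W) := by
        apply b.ext
        intro i
        rw [hd, heq i i0]; simp
      rw [this]; simp


open Module in
def restrictHom {H W : Type*} [Group H] [AddCommGroup W] [Module ℂ W] (σ : H →* End ℂ W)
    (U : Submodule ℂ W) (hU : ∀ h, ∀ x ∈ U, σ h x ∈ U) : H →* End ℂ U where
  toFun h := (σ h).restrict (hU h)
  map_one' := by
    ext x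
    simp [LinearMap.restrict_apply]
  map_mul' a b := by
    ext x
    simp [LinearMap.restrict_apply]

open Module in
theorem comm_of_conn {H : Type*} [Group H] [Group.FG H] (A : Subalgebra ℂ (H → ℂ))
    (hp : ∀ f ∈ A, ∀ g ∈ A, (∀ h, f h * g h = 0) → (∀ h, f h = 0) ∨ (∀ h, g h = 0))
    (hfree : ¬ ∃ f : FreeGroup (Fin 2) →* H, Function.Injective f) (n : ℕ) :
    ∀ (W : Type u) [NormedAddCommGroup W] [InnerProductSpace ℂ W]
    [FiniteDimensional ℂ W] (σ : H →* End ℂ W) (_ : ∀ g x, ‖σ g x‖ = ‖x‖)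
    (_ : ∀ (l : Dual ℂ W) x, (fun γ => l (σ γ x)) ∈ A)
    (_ : ∀ (l : Dual ℂ W) x, (fun γ => l (σ γ⁻¹ x)) ∈ A) (_ : finrank ℂ W = n),
    ∀ g h x, σ g (σ h x) = σ h (σ g x) := by
  induction n using Nat.strong_induction_on with
  | _ n ih =>
  intro W _ _ _ σ hσ h1 h2 hn
  by_cases hirr : ∀ U : Submodule ℂ W, (∀ h, ∀ x ∈ U, σ h x ∈ U) → U = ⊥ ∨ U = ⊤
  · intro g h x
    obtain ⟨c, hc⟩ := irr_scalar σ hσ A h1 h2 hp hirr hfree g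
    rw [hc, hc, map_smul]
  · push Not at hirr
    obtain ⟨U, hU, hbot, htop⟩ := hirr
    have hU' : ∀ h, ∀ x ∈ Uᗮ, σ h x ∈ Uᗮ := fun h => isom_orth (σ h) (hσ h) U (hU h)
    have main : ∀ (Y : Submodule ℂ W) (hY : ∀ h, ∀ x ∈ Y, σ h x ∈ Y), finrank ℂ Y < n →
        ∀ g h, ∀ x ∈ Y, σ g (σ h x) = σ h (σ g x) := by
      intro Y hY hlt g h x hx
      have := ih _ hlt Y (restrictHom σ Y hY) (fun g x => hσ g x) (by
          intro l x
          obtain ⟨l', hl'⟩ := LinearMap.exists_extend l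
          rw [← hl']
          exact h1 l' x) (by
          intro l x
          obtain ⟨l', hl'⟩ := LinearMap.exists_extend l
          rw [← hl']
          exact h2 l' x) rfl g h ⟨x, hx⟩
      exact congrArg Subtype.val this
    have d1 : finrank ℂ U < n := hn ▸ Submodule.finrank_lt htop
    have d2 : finrank ℂ Uᗮ < n := by
      rw [← hn]
      apply Submodule.finrank_lt
      intro h
      exact hbot ((Submodule.orthogonal_eq_top_iff _).1 h)
    intro g h x
    obtain ⟨y, hy, z, hz, rfl⟩ := U.exists_add_mem_mem_orthogonal x
    simp only [map_add]
    rw [main U hU d1 g h y hy, main Uᗮ hU' d2 g h z hz]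

open Module in
theorem thmA {G : Type*} {V : Type u} [Group G] [Group.FG G] [NormedAddCommGroup V] [InnerProductSpace ℂ V]
    [FiniteDimensional ℂ V] (ρ : G →* End ℂ V) (hρ : ∀ g x, ‖ρ g x‖ = ‖x‖)
    (hfree : ¬ ∃ f : FreeGroup (Fin 2) →* G, Function.Injective f) :
    ∃ H0 : Subgroup G, H0.FiniteIndex ∧ ∀ g ∈ H0, ∀ h ∈ H0, ρ g * ρ h = ρ h * ρ g := by
  obtain ⟨H0, hfin, A, h1, h2, hp⟩ := conn_rep ρ
  refine ⟨H0, hfin, fun g hg h hh => ?_⟩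
  haveI : Group.FG H0 := inferInstance
  ext x
  exact comm_of_conn A hp (fun ⟨f, hf⟩ => hfree ⟨H0.subtype.comp f, Subtype.val_injective.comp hf⟩) _ V
    (ρ.comp H0.subtype) (fun g x => hρ g x) h1 h2 rfl ⟨g, hg⟩ ⟨h, hh⟩ x


open Module in
theorem kl_lemma {V : Type*} [NormedAddCommGroup V] [InnerProductSpace ℂ V] [FiniteDimensional ℂ V]
    (T T' h : End ℂ V) (hT : ∀ x, ‖T x‖ = ‖x‖) (hh : ∀ x, ‖h x‖ = ‖x‖)
    (hconj : ∀ x, T' (h x) = h (T x)) (hcomm : ∀ x, T (T' x) = T' (T x))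
    (hnear : ∀ x, ‖h x - x‖ ≤ 1 / 2 * ‖x‖) : ∀ x, T (h x) = h (T x) := by
  have hhinj : Function.Injective h := by
    rw [← LinearMap.ker_eq_bot, LinearMap.ker_eq_bot']
    intro m hm
    have h2 := hh m
    rw [hm, norm_zero] at h2
    exact norm_eq_zero.1 h2.symm
  have hhsurj : Function.Surjective h := LinearMap.injective_iff_surjective.1 hhinj
  have key : ∀ (c : ℂ) (x : V), T' x = c • x → T x = c • x := by
    intro c x hx
    let E := End.eigenspace T' c
    have hE : ∀ x ∈ E, T x ∈ E := by
      intro x hx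
      rw [End.mem_eigenspace_iff] at hx ⊢
      rw [← hcomm, hx, map_smul]
    obtain ⟨b, d, hd⟩ := isom_eigenbasis (T.restrict hE) (fun x => hT x)
    have hdc : ∀ i, d i = c := by
      intro i
      by_contra hne
      have hy : T (b i) = d i • (b i : V) := congrArg Subtype.val (hd i)
      have hy' : T' (b i) = c • (b i : V) := End.mem_eigenspace_iff.1 (b i).2
      have hy0 : (b i : V) ≠ 0 := fun h0 => b.ne_zero i (Subtype.ext h0)
      generalize (b i : V) = y at *
      obtain ⟨z, rfl⟩ := hhsurj y
      have hz : T z = c • z := by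
        apply hhinj
        rw [← hconj, hy', map_smul]
      have hz0 : z ≠ 0 := by
        rintro rfl
        simp at hy0
      have hc1 : ‖c‖ = 1 := by
        have := hT z
        rw [hz, norm_smul] at this
        exact (mul_eq_right₀ (norm_ne_zero_iff.2 hz0)).1 this
      have horth : inner ℂ z (h z) = 0 := by
        have h3 := isom_inner T hT z (h z)
        rw [hz, hy, inner_smul_left, inner_smul_right] at h3
        by_contra hi
        have h4 : (starRingEnd ℂ) c * d i = 1 := by
          apply mul_right_cancel₀ hi
          rw [one_mul, mul_assoc]; exact h3
        apply hne
        have h5 : c * (starRingEnd ℂ) c = 1 := by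
          rw [Complex.mul_conj, Complex.normSq_eq_norm_sq, hc1]; norm_num
        calc d i = (c * (starRingEnd ℂ) c) * d i := by rw [h5, one_mul]
          _ = c := by rw [mul_assoc, h4, mul_one]
      have h6 : ‖h z - z‖ ^ 2 = ‖h z‖ ^ 2 + ‖z‖ ^ 2 := by
        have := norm_sub_sq (𝕜 := ℂ) (h z) z
        rw [this, ← inner_conj_symm, horth]; simp
      rw [hh] at h6
      have h7 := hnear z
      have h8 := norm_nonneg (h z - z)
      have h9 := norm_pos_iff.2 hz0
      nlinarith
    have hTE : ∀ e : E, (T.restrict hE) e = c • e := by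
      have : T.restrict hE = c • (1 : End ℂ E) := by
        apply b.ext
        intro i
        rw [hd, hdc]; simp
      intro e
      rw [this]; simp
    exact congrArg Subtype.val (hTE ⟨x, End.mem_eigenspace_iff.2 hx⟩)
  obtain ⟨b, d, hd⟩ := isom_eigenbasis T hT
  have : T ∘ₗ h = h ∘ₗ T := by
    apply b.ext
    intro i
    simp only [LinearMap.comp_apply]
    rw [hd, map_smul]
    apply key
    rw [hconj, hd, map_smul]
  intro x
  exact LinearMap.congr_fun this x

open Module in
theorem near_comm {G : Type*} {V : Type u} [Group G] [NormedAddCommGroup V] [InnerProductSpace ℂ V]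
    [FiniteDimensional ℂ V] (ρ : G →* End ℂ V) (hρ : ∀ g x, ‖ρ g x‖ = ‖x‖)
    (hfree : ¬ ∃ f : FreeGroup (Fin 2) →* G, Function.Injective f) [Group.FG G] (a b : G)
    (hgen : Subgroup.closure {a, b} = ⊤)
    (ha : ∀ x, ‖ρ a x - x‖ ≤ 1 / 4 * ‖x‖) (hb : ∀ x, ‖ρ b x - x‖ ≤ 1 / 4 * ‖x‖) :
    ρ a * ρ b = ρ b * ρ a := by
  obtain ⟨H0, hfin, hcomm⟩ := thmA ρ hρ hfree
  let N := H0.normalCore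
  haveI hNfin : N.FiniteIndex := inferInstance
  have hN : ∀ g ∈ N, ∀ h ∈ N, ρ g * ρ h = ρ h * ρ g := fun g hg h hh =>
    hcomm g (H0.normalCore_le hg) h (H0.normalCore_le hh)
  have kl : ∀ t h : G, ρ t * ρ (h * t * h⁻¹) = ρ (h * t * h⁻¹) * ρ t →
      (∀ x, ‖ρ h x - x‖ ≤ 1 / 4 * ‖x‖) → ρ t * ρ h = ρ h * ρ t := by
    intro t h hc hn
    ext x
    refine kl_lemma (ρ t) (ρ (h * t * h⁻¹)) (ρ h) (hρ t) (hρ h) ?_ ?_ ?_ x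
    · intro x
      rw [← Module.End.mul_apply, ← Module.End.mul_apply, ← map_mul, ← map_mul]
      simp
    · intro x
      exact LinearMap.congr_fun hc x
    · intro x
      have := hn x
      have := norm_nonneg x
      linarith
  have hcen : ∀ t ∈ N, ∀ g : G, ρ t * ρ g = ρ g * ρ t := by
    intro t ht g
    have hg : g ∈ Subgroup.closure {a, b} := by rw [hgen]; trivial
    induction hg using Subgroup.closure_induction with
    | mem g hg =>
      apply kl t g (hN _ ht _ (Subgroup.Normal.conj_mem inferInstance t ht g))
      rcases hg with rfl | hg
      · exact ha
      · rw [Set.mem_singleton_iff.1 hg]; exact hb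
    | one => simp
    | mul x y _ _ hx hy => rw [map_mul, ← mul_assoc, hx, mul_assoc, hy, mul_assoc]
    | inv x _ hx =>
      have h1 : ρ x⁻¹ * ρ x = 1 := by rw [← map_mul]; simp
      have h2 : ρ x * ρ x⁻¹ = 1 := by rw [← map_mul]; simp
      calc ρ t * ρ x⁻¹ = ρ x⁻¹ * (ρ x * ρ t) * ρ x⁻¹ := by rw [← mul_assoc, h1, one_mul]
        _ = ρ x⁻¹ * ρ t := by rw [← hx, mul_assoc, mul_assoc, h2, mul_one]
  -- finiteness of the set of commutators
  have hfinset : (Set.range fun x : G => ρ (a * x * a⁻¹ * x⁻¹)).Finite := by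
    have : (Set.range fun x : G => ρ (a * x * a⁻¹ * x⁻¹)) ⊆
        Set.range (fun q : G ⧸ N => ρ (a * q.out * a⁻¹ * q.out⁻¹)) := by
      rintro _ ⟨x, rfl⟩
      refine ⟨(x : G ⧸ N), ?_⟩
      obtain ⟨t, ht⟩ := QuotientGroup.mk_out_eq_mul N x
      simp only [ht]
      have : a * (x * (t : G)) * a⁻¹ * (x * (t : G))⁻¹ = a * x * ((t : G) * (a⁻¹ * (t : G)⁻¹)) * x⁻¹ := by group
      rw [this]
      have h3 : ρ ((t : G) * (a⁻¹ * (t : G)⁻¹)) = ρ a⁻¹ := by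
        rw [map_mul, hcen t t.2, ← map_mul]; simp
      rw [map_mul, map_mul, h3, ← map_mul, ← map_mul]
    exact (Set.finite_range _).subset this
  let u : ℕ → G := fun k => Nat.rec b (fun _ h => a * h * a⁻¹ * h⁻¹) k
  have u0 : u 0 = b := rfl
  have us : ∀ k, u (k + 1) = a * u k * a⁻¹ * (u k)⁻¹ := fun k => rfl
  have hu : ∀ k x, ‖ρ (u k) x - x‖ ≤ (1 / 2 : ℝ) ^ k * (1 / 4) * ‖x‖ := by
    intro k
    induction k with
    | zero => intro x; simpa [u0] using hb x
    | succ k ih =>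
      intro x
      let y := ρ (a⁻¹ * (u k)⁻¹) x
      have hy : ‖y‖ = ‖x‖ := hρ _ _
      have e1 : ρ (u (k + 1)) x = ρ a (ρ (u k) y) := by
        simp only [y, us]
        rw [← Module.End.mul_apply, ← Module.End.mul_apply, ← map_mul, ← map_mul]
        simp [mul_assoc]
      have e2 : x = ρ (u k) (ρ a y) := by
        simp only [y]
        rw [← Module.End.mul_apply, ← Module.End.mul_apply, ← map_mul, ← map_mul]
        simp
      have e3 : ρ (u (k + 1)) x - x = (ρ a (ρ (u k) y - y) - (ρ (u k) y - y)) -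
          (ρ (u k) (ρ a y - y) - (ρ a y - y)) := by
        rw [e1]
        conv_lhs => rw [e2]
        simp only [map_sub]
        abel
      rw [e3]
      have b1 := ha (ρ (u k) y - y)
      have b2 := ih y
      have b3 := ih (ρ a y - y)
      have b4 := ha y
      rw [hy] at b2 b4
      have hpk : (0 : ℝ) < (1 / 2) ^ k := by positivity
      calc _ ≤ _ := norm_sub_le _ _
        _ ≤ 1 / 4 * ((1 / 2 : ℝ) ^ k * (1 / 4) * ‖x‖) + (1 / 2 : ℝ) ^ k * (1 / 4) * (1 / 4 * ‖x‖) := by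
          refine add_le_add (b1.trans ?_) (b3.trans ?_)
          · exact mul_le_mul_of_nonneg_left b2 (by norm_num)
          · exact mul_le_mul_of_nonneg_left b4 (by positivity)
        _ = _ := by rw [pow_succ]; ring
  have hone : ∃ k, ρ (u (k + 1)) = 1 := by
    haveI : Finite (Set.range fun x : G => ρ (a * x * a⁻¹ * x⁻¹)) := hfinset
    obtain ⟨⟨T, hT⟩, hinf⟩ := Finite.exists_infinite_fiber
      (fun k : ℕ => (⟨ρ (u (k + 1)), ⟨u k, rfl⟩⟩ : Set.range fun x : G => ρ (a * x * a⁻¹ * x⁻¹)))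
    have hinf' := Set.infinite_coe_iff.1 hinf
    have hT1 : T = 1 := by
      ext x
      have hlim : Filter.Tendsto (fun k : ℕ => (1 / 2 : ℝ) ^ k * (1 / 4) * ‖x‖) Filter.atTop (nhds (0 * (1 / 4) * ‖x‖)) :=
        ((tendsto_pow_atTop_nhds_zero_of_lt_one (by norm_num) (by norm_num)).mul_const _).mul_const _
      have hle : ‖T x - x‖ ≤ 0 := by
        by_contra! hpos
        rw [zero_mul, zero_mul] at hlim
        obtain ⟨K, hK⟩ := Filter.eventually_atTop.1 (hlim.eventually (gt_mem_nhds hpos))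
        obtain ⟨k, hk, hkK⟩ := hinf'.exists_gt K
        have h1 : ρ (u (k + 1)) = T := congrArg Subtype.val hk
        have h2 := hu (k + 1) x
        rw [h1] at h2
        have h3 := hK (k + 1) (by omega)
        linarith
      have := norm_le_zero_iff.1 hle
      simpa [sub_eq_zero] using this
    obtain ⟨k, hk⟩ := hinf'.nonempty
    exact ⟨k, (congrArg Subtype.val hk).trans hT1⟩
  have hdesc : ∀ k, ρ a * ρ (u (k + 1)) = ρ (u (k + 1)) * ρ a → ρ a * ρ (u k) = ρ (u k) * ρ a := by
    intro k hk
    apply kl a (u k)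
    · -- a commutes with u (k+1) = a * (u a⁻¹ u⁻¹)
      let c := u k * a * (u k)⁻¹
      have e : u (k + 1) = a * c⁻¹ := by rw [us]; simp only [c]; group
      rw [e, ← map_mul, ← map_mul] at hk
      change ρ a * ρ c = ρ c * ρ a
      have h4 : ρ (a * (a * c⁻¹)) = ρ ((a * c⁻¹) * a) := hk
      have h5 : ρ (c * (a⁻¹ * (a * (a * c⁻¹))) * c) = ρ (c * (a⁻¹ * ((a * c⁻¹) * a)) * c) := by
        rw [map_mul, map_mul ρ c, map_mul ρ a⁻¹, h4, ← map_mul, ← map_mul, ← map_mul]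
      have e1 : c * (a⁻¹ * (a * (a * c⁻¹))) * c = c * a := by group
      have e2 : c * (a⁻¹ * ((a * c⁻¹) * a)) * c = a * c := by group
      rw [e1, e2] at h5
      rw [← map_mul, ← map_mul, h5]
    · intro x
      refine (hu k x).trans ?_
      have : (1 / 2 : ℝ) ^ k ≤ 1 := pow_le_one₀ (by norm_num) (by norm_num)
      have h6 := norm_nonneg x
      nlinarith
  obtain ⟨k, hk⟩ := hone
  have hP : ∀ j, ρ a * ρ (u j) = ρ (u j) * ρ a → ρ a * ρ (u 0) = ρ (u 0) * ρ a := by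
    intro j
    induction j with
    | zero => exact id
    | succ j ih => exact fun h => ih (hdesc j h)
  exact hP (k + 1) (by rw [hk, mul_one, one_mul])


open Module in
theorem thmB {G : Type*} {V : Type u} [Group G] [NormedAddCommGroup V] [InnerProductSpace ℂ V]
    [FiniteDimensional ℂ V] (ρ : G →* End ℂ V) (hρ : ∀ g x, ‖ρ g x‖ = ‖x‖)
    (hfree : ¬ ∃ f : FreeGroup (Fin 2) →* G, Function.Injective f) :
    ∃ H : Subgroup G, H.FiniteIndex ∧ ∀ g ∈ H, ∀ h ∈ H, ρ g * ρ h = ρ h * ρ g := by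
  let U : Set G := {g | ∀ x, ‖ρ g x - x‖ ≤ 1 / 4 * ‖x‖}
  have hU : ∀ a ∈ U, ∀ b ∈ U, ρ a * ρ b = ρ b * ρ a := by
    intro a ha b hb
    let Γ : Subgroup G := Subgroup.closure {a, b}
    have haΓ : a ∈ Γ := Subgroup.subset_closure (by simp)
    have hbΓ : b ∈ Γ := Subgroup.subset_closure (by simp)
    have hgen : Subgroup.closure {(⟨a, haΓ⟩ : Γ), ⟨b, hbΓ⟩} = ⊤ := by
      have h1 := Subgroup.closure_closure_coe_preimage (k := ({a, b} : Set G))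
      rw [← h1]
      congr 1
      ext ⟨x, hx⟩
      simp
    haveI : Group.FG Γ := by
      classical
      exact ⟨⟨{(⟨a, haΓ⟩ : Γ), ⟨b, hbΓ⟩}, by rw [← hgen]; simp⟩⟩
    have hfree' : ¬ ∃ f : FreeGroup (Fin 2) →* Γ, Function.Injective f := by
      rintro ⟨f, hf⟩
      exact hfree ⟨Γ.subtype.comp f, Γ.subtype_injective.comp hf⟩
    exact near_comm (ρ.comp Γ.subtype) (fun g x => hρ g x) hfree' ⟨a, haΓ⟩ ⟨b, hbΓ⟩ hgen ha hb
  let H := Subgroup.closure U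
  have hcomm1 : ∀ (T : End ℂ V), (∀ a ∈ U, ρ a * T = T * ρ a) → ∀ g ∈ H, ρ g * T = T * ρ g := by
    intro T hT g hg
    induction hg using Subgroup.closure_induction with
    | mem g hg => exact hT g hg
    | one => simp
    | mul x y _ _ hx hy => rw [map_mul, mul_assoc, hy, ← mul_assoc, hx, mul_assoc]
    | inv x _ hx =>
      have h1 : ρ x⁻¹ * ρ x = 1 := by rw [← map_mul]; simp
      have h2 : ρ x * ρ x⁻¹ = 1 := by rw [← map_mul]; simp
      calc ρ x⁻¹ * T = ρ x⁻¹ * (T * ρ x) * ρ x⁻¹ := by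
            rw [mul_assoc, mul_assoc, h2, mul_one]
        _ = T * ρ x⁻¹ := by rw [← hx, ← mul_assoc, h1, one_mul]
  refine ⟨H, ?_, ?_⟩
  · let φ : G → (V →L[ℂ] V) := fun g => LinearMap.toContinuousLinearMap (ρ g)
    have hφ : ∀ g x, φ g x = ρ g x := fun g x => rfl
    haveI : ProperSpace (V →L[ℂ] V) := FiniteDimensional.proper ℂ _
    have htb : TotallyBounded (Metric.closedBall (0 : V →L[ℂ] V) 1) :=
      (isCompact_closedBall _ _).totallyBounded
    obtain ⟨t, htfin, ht⟩ := Metric.totallyBounded_iff.1 htb (1 / 8) (by norm_num)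
    have hmem : ∀ g, ∃ c : t, dist (φ g) c < 1 / 8 := by
      intro g
      have h1 : φ g ∈ Metric.closedBall (0 : V →L[ℂ] V) 1 := by
        rw [mem_closedBall_zero_iff]
        refine ContinuousLinearMap.opNorm_le_bound _ (by norm_num) fun x => ?_
        rw [hφ, hρ, one_mul]
      have h2 := ht h1
      simp only [Set.mem_iUnion, Metric.mem_ball] at h2
      obtain ⟨c, hc, hd⟩ := h2
      exact ⟨⟨c, hc⟩, hd⟩
    choose F hF using hmem
    haveI : Finite t := htfin
    have hinj : Function.Injective (fun q : G ⧸ H => F q.out) := by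
      intro p q hpq
      have h1 : dist (φ p.out) (φ q.out) ≤ 1 / 4 := by
        have e1 := hF p.out
        have e2 := hF q.out
        simp only at hpq
        rw [hpq] at e1
        rw [dist_comm] at e2
        have := dist_triangle (φ p.out) (F q.out : V →L[ℂ] V) (φ q.out)
        linarith
      rw [← QuotientGroup.out_eq' p, ← QuotientGroup.out_eq' q, QuotientGroup.eq]
      apply Subgroup.subset_closure
      intro x
      have h2 : ρ (p.out⁻¹ * q.out) x - x = ρ p.out⁻¹ (ρ q.out x - ρ p.out x) := by
        rw [map_sub, ← Module.End.mul_apply, ← Module.End.mul_apply, ← map_mul, ← map_mul]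
        simp
      rw [h2, hρ, norm_sub_rev]
      have h3 := (φ p.out - φ q.out).le_opNorm x
      rw [dist_eq_norm] at h1
      exact h3.trans (mul_le_mul_of_nonneg_right h1 (norm_nonneg x))
    haveI : Finite (G ⧸ H) := Finite.of_injective _ hinj
    exact Subgroup.finiteIndex_of_finite_quotient
  · intro g hg h hh
    refine hcomm1 (ρ h) (fun a ha => ?_) g hg
    exact (hcomm1 (ρ a) (fun b hb => hU b hb a ha) h hh).symm


/-- Complexification of a real operator on Euclidean space. -/
noncomputable def cplxHom (d : ℕ) : Module.End ℝ (EuclideanSpace ℝ (Fin d)) →*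
    Module.End ℂ (EuclideanSpace ℂ (Fin d)) where
  toFun A :=
    { toFun := fun z => WithLp.toLp 2 fun i =>
        (⟨A (WithLp.toLp 2 fun j => (z j).re) i, A (WithLp.toLp 2 fun j => (z j).im) i⟩ : ℂ)
      map_add' := by
        intro z w
        have h1 : (WithLp.toLp 2 fun j => ((z + w) j).re : EuclideanSpace ℝ (Fin d)) =
          (WithLp.toLp 2 fun j => (z j).re) + (WithLp.toLp 2 fun j => (w j).re) := by
          ext j; simp
        have h2 : (WithLp.toLp 2 fun j => ((z + w) j).im : EuclideanSpace ℝ (Fin d)) =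
          (WithLp.toLp 2 fun j => (z j).im) + (WithLp.toLp 2 fun j => (w j).im) := by
          ext j; simp
        rw [h1, h2, map_add, map_add]
        ext i
        apply Complex.ext <;> simp
      map_smul' := by
        intro c z
        have h1 : (WithLp.toLp 2 fun j => ((c • z) j).re : EuclideanSpace ℝ (Fin d)) =
          c.re • (WithLp.toLp 2 fun j => (z j).re) - c.im • (WithLp.toLp 2 fun j => (z j).im) := by
          ext j; simp
        have h2 : (WithLp.toLp 2 fun j => ((c • z) j).im : EuclideanSpace ℝ (Fin d)) =
          c.re • (WithLp.toLp 2 fun j => (z j).im) + c.im • (WithLp.toLp 2 fun j => (z j).re) := by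
          ext j; simp
        rw [h1, h2, map_add, map_sub, map_smul, map_smul, map_smul, map_smul]
        ext i
        apply Complex.ext <;> simp }
  map_one' := by
    ext z i
    apply Complex.ext <;> simp
  map_mul' A B := by
    apply LinearMap.ext
    intro z
    ext i
    apply Complex.ext <;> simp

theorem cplxHom_norm {d : ℕ} (A : Module.End ℝ (EuclideanSpace ℝ (Fin d)))
    (hA : ∀ x, ‖A x‖ = ‖x‖) (z : EuclideanSpace ℂ (Fin d)) : ‖cplxHom d A z‖ = ‖z‖ := by
  have hz : ∀ w : EuclideanSpace ℂ (Fin d), ‖w‖ ^ 2 =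
      ‖(WithLp.toLp 2 fun j => (w j).re : EuclideanSpace ℝ (Fin d))‖ ^ 2 +
      ‖(WithLp.toLp 2 fun j => (w j).im : EuclideanSpace ℝ (Fin d))‖ ^ 2 := by
    intro w
    rw [EuclideanSpace.norm_sq_eq, EuclideanSpace.norm_sq_eq, EuclideanSpace.norm_sq_eq,
      ← Finset.sum_add_distrib]
    refine Finset.sum_congr rfl fun i _ => ?_
    rw [← Complex.normSq_eq_norm_sq, Complex.normSq_apply]
    simp [sq]
  have h : ‖cplxHom d A z‖ ^ 2 = ‖z‖ ^ 2 := by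
    rw [hz, hz z, ← hA (WithLp.toLp 2 fun j => (z j).re), ← hA (WithLp.toLp 2 fun j => (z j).im)]
    rfl
  exact (sq_eq_sq₀ (norm_nonneg _) (norm_nonneg _)).1 h

theorem cplxHom_inj {d : ℕ} (A : Module.End ℝ (EuclideanSpace ℝ (Fin d)))
    (hA : cplxHom d A = 1) (x : EuclideanSpace ℝ (Fin d)) : A x = x := by
  have h := LinearMap.congr_fun hA (WithLp.toLp 2 fun j => (x j : ℂ))
  ext i
  have h2 := congrArg (fun z : EuclideanSpace ℂ (Fin d) => (z i).re) h
  exact h2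

/-- The linear part of an isometry of Euclidean space. -/
noncomputable def linPart (d : ℕ) : (EuclideanSpace ℝ (Fin d) ≃ᵢ EuclideanSpace ℝ (Fin d)) →*
    Module.End ℝ (EuclideanSpace ℝ (Fin d)) where
  toFun g := g.toRealAffineIsometryEquiv.linearIsometryEquiv.toLinearEquiv.toLinearMap
  map_one' := by
    apply LinearMap.ext
    intro x
    have h := (1 : EuclideanSpace ℝ (Fin d) ≃ᵢ EuclideanSpace ℝ (Fin d)).toRealAffineIsometryEquiv.map_vadd 0 x
    simpa using h.symm
  map_mul' g h := by
    apply LinearMap.ext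
    intro x
    have key : ∀ (k : EuclideanSpace ℝ (Fin d) ≃ᵢ EuclideanSpace ℝ (Fin d))
        (p v : EuclideanSpace ℝ (Fin d)),
        k (v + p) = k.toRealAffineIsometryEquiv.linearIsometryEquiv v + k p := fun k p v =>
      k.toRealAffineIsometryEquiv.map_vadd p v
    have e1 := key (g * h) 0 x
    have e2 := key g (h 0) (h.toRealAffineIsometryEquiv.linearIsometryEquiv x)
    have e3 := key h 0 x
    rw [IsometryEquiv.mul_apply, IsometryEquiv.mul_apply] at e1
    rw [e3, e2] at e1
    exact (add_right_cancel e1).symm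

theorem linPart_spec {d : ℕ} (g : EuclideanSpace ℝ (Fin d) ≃ᵢ EuclideanSpace ℝ (Fin d))
    (x : EuclideanSpace ℝ (Fin d)) : g x = linPart d g x + g 0 := by
  have h := g.toRealAffineIsometryEquiv.map_vadd 0 x
  simp only [vadd_eq_add, add_zero] at h
  exact h

theorem linPart_norm {d : ℕ} (g : EuclideanSpace ℝ (Fin d) ≃ᵢ EuclideanSpace ℝ (Fin d))
    (x : EuclideanSpace ℝ (Fin d)) : ‖linPart d g x‖ = ‖x‖ :=
  g.toRealAffineIsometryEquiv.linearIsometryEquiv.norm_map x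

/-- Any subgroup `S` of the isometry group of Euclidean space `ℝ^d` that contains no
non-abelian free subgroup (no subgroup isomorphic to the free group of rank 2) is
virtually metabelian: `S` has a finite index subgroup `H` whose commutator subgroup
is abelian. -/
theorem stmt_17 {d : ℕ} (hd : 0 < d)
    (S : Subgroup (EuclideanSpace ℝ (Fin d) ≃ᵢ EuclideanSpace ℝ (Fin d)))
    (hfree : ¬ ∃ f : FreeGroup (Fin 2) →* ↥S, Function.Injective f) :
    ∃ H : Subgroup ↥S, H.FiniteIndex ∧
      ∀ x y : ↥H, x ∈ commutator ↥H → y ∈ commutator ↥H → x * y = y * x := by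
  let ρ : ↥S →* Module.End ℂ (EuclideanSpace ℂ (Fin d)) :=
    (cplxHom d).comp ((linPart d).comp S.subtype)
  have hρ : ∀ g x, ‖ρ g x‖ = ‖x‖ := by
    intro g x
    apply cplxHom_norm
    intro y
    exact linPart_norm _ y
  obtain ⟨H, hfin, hcomm⟩ := thmB ρ hρ hfree
  refine ⟨H, hfin, ?_⟩
  have hker : commutator ↥H ≤ (ρ.comp H.subtype).ker := by
    rw [commutator_def, Subgroup.commutator_le]
    intro g _ h _
    rw [MonoidHom.mem_ker, commutatorElement_def]
    have h1 : (ρ.comp H.subtype) (g * h) = (ρ.comp H.subtype) (h * g) := by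
      rw [map_mul, map_mul]; exact hcomm g g.2 h h.2
    rw [mul_assoc, map_mul, h1, ← map_mul]
    have : h * g * (g⁻¹ * h⁻¹) = 1 := by group
    rw [this, map_one]
  have htr : ∀ x ∈ commutator ↥H, ∀ v : EuclideanSpace ℝ (Fin d),
      ((x : ↥S) : EuclideanSpace ℝ (Fin d) ≃ᵢ EuclideanSpace ℝ (Fin d)) v =
      v + ((x : ↥S) : EuclideanSpace ℝ (Fin d) ≃ᵢ EuclideanSpace ℝ (Fin d)) 0 := by
    intro x hx v
    have h1 : cplxHom d (linPart d ((x : ↥S) : EuclideanSpace ℝ (Fin d) ≃ᵢ _)) = 1 :=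
      MonoidHom.mem_ker.1 (hker hx)
    rw [linPart_spec, cplxHom_inj _ h1]
  intro x y hx hy
  apply Subtype.ext
  apply Subtype.ext
  ext1 v
  simp only [Subgroup.coe_mul, IsometryEquiv.mul_apply]
  rw [htr x hx (_), htr y hy v, htr x hx v, htr y hy (v + _)]
  abel
end

section
/- Let d be a positive integer, let G be a finitely generated subgroup of the isometry group of Euclidean space ℝ^d, and let γ ∈ G be an element of infinite order. Then the infinite cyclic subgroup ⟨γ⟩ is undistorted in G: for any finite generating set S of G there exists c > 0 such that l_S(γⁿ) ≥ c·|n| for all integers n, where l_S denotes word length with respect to S. -/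
/-- The word length of `g` with respect to a generating set `S`: the least `n` such that
`g` is a product of `n` elements of `S ∪ S⁻¹`. -/
noncomputable def wordLength {G : Type*} [Group G] (S : Set G) (g : G) : ℕ :=
  sInf {n | ∃ l : List G, l.length = n ∧ (∀ x ∈ l, x ∈ S ∨ x⁻¹ ∈ S) ∧ l.prod = g}

section Arith
open Cardinal

lemma exists_ext_equiv {R K L : Type} [CommRing R] [Field K] [Field L]
    [IsAlgClosed K] [IsAlgClosed L] [Algebra R K] [Algebra R L]
    [Nontrivial R] [FaithfulSMul R K] [FaithfulSMul R L] (hR : #R ≤ ℵ₀) (hK : ℵ₀ < #K) (hKL : #K = #L) :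
    ∃ φ : K →+* L, ∀ r : R, φ (algebraMap R K r) = algebraMap R L r := by
  obtain ⟨s, hv⟩ := exists_isTranscendenceBasis R K
  obtain ⟨t, hw⟩ := exists_isTranscendenceBasis R L
  have h1 := IsAlgClosed.cardinal_eq_cardinal_transcendence_basis_of_aleph0_lt' _ hv hR hK
  have h2 := IsAlgClosed.cardinal_eq_cardinal_transcendence_basis_of_aleph0_lt' _ hw hR (hKL ▸ hK)
  obtain ⟨e⟩ := Cardinal.eq.1 (h1.symm.trans (hKL.trans h2))
  let := IsAlgClosed.isAlgClosure_of_transcendence_basis _ hv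
  let := IsAlgClosed.isAlgClosure_of_transcendence_basis _ hw
  let e' := (hv.1.aevalEquiv.symm.trans (MvPolynomial.renameEquiv R e)).trans hw.1.aevalEquiv
  refine ⟨(IsAlgClosure.equivOfEquiv K L e'.toRingEquiv : K ≃+* L), fun r => ?_⟩
  have := IsAlgClosure.equivOfEquiv_algebraMap (S := Algebra.adjoin R (Set.range ((↑) : s → K)))
    (R := Algebra.adjoin R (Set.range ((↑) : t → L))) K L e'.toRingEquiv (algebraMap R _ r)
  rw [← IsScalarTower.algebraMap_apply] at this
  rw [IsScalarTower.algebraMap_apply R (Algebra.adjoin R (Set.range ((↑) : t → L))) L, ← e'.commutes]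
  exact this

lemma card_padic (p : ℕ) [Fact p.Prime] : #(PadicAlgCl p) = #ℂ := by
  rw [Cardinal.mk_complex]
  have h : #ℚ_[p] = 𝔠 := by
    apply le_antisymm
    · calc #ℚ_[p] ≤ #(PadicSeq p) := Cardinal.mk_quotient_le
        _ ≤ #(ℕ → ℚ) := Cardinal.mk_subtype_le _
        _ = 𝔠 := by simp
    · simpa using continuum_le_cardinal_of_nontriviallyNormedField ℚ_[p]
  apply le_antisymm
  · have := Algebra.IsAlgebraic.cardinalMk_le_max ℚ_[p] (PadicAlgCl p)
    rw [h] at this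
    simpa [Cardinal.aleph0_le_continuum] using this
  · rw [← h]
    exact Cardinal.mk_le_of_injective (algebraMap ℚ_[p] (PadicAlgCl p)).injective

/-- ring hom from ℂ to a normed field extending a given one -/
lemma ext_of_emb {L : Type} [NormedField L] [IsAlgClosed L] [CharZero L] (hL : #L = #ℂ) (z : ℂ)
    (hz : IsIntegral ℚ z) (g : IntermediateField.adjoin ℚ {z} →+* L) :
    ∃ φ : ℂ →+* L, φ z = g (IntermediateField.AdjoinSimple.gen ℚ z) := by
  let : Algebra (IntermediateField.adjoin ℚ {z}) L := g.toAlgebra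
  have : Algebra.IsAlgebraic ℚ (IntermediateField.adjoin ℚ {z}) :=
    IntermediateField.isAlgebraic_adjoin (by simpa using hz)
  have hR : #(IntermediateField.adjoin ℚ {z}) ≤ ℵ₀ := by
    simpa using Algebra.IsAlgebraic.cardinalMk_le_max ℚ (IntermediateField.adjoin ℚ {z})
  obtain ⟨φ, hφ⟩ := exists_ext_equiv (R := IntermediateField.adjoin ℚ {z}) (K := ℂ) (L := L) hR
    (by rw [Cardinal.mk_complex]; exact Cardinal.aleph0_lt_continuum) hL.symm
  exact ⟨φ, hφ (IntermediateField.AdjoinSimple.gen ℚ z)⟩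

lemma exists_ext_equiv' {R K L : Type} [CommRing R] [Field K] [Field L]
    [IsAlgClosed K] [IsAlgClosed L] (f : R →+* K) (g : R →+* L) (hf : Function.Injective f)
    (hg : Function.Injective g)
    [Nontrivial R] (hR : #R ≤ ℵ₀) (hK : ℵ₀ < #K) (hKL : #K = #L) :
    ∃ φ : K →+* L, ∀ r : R, φ (f r) = g r := by
  let _ := f.toAlgebra
  let _ := g.toAlgebra
  have : FaithfulSMul R K := (faithfulSMul_iff_algebraMap_injective R K).2 hf
  have : FaithfulSMul R L := (faithfulSMul_iff_algebraMap_injective R L).2 hg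
  exact exists_ext_equiv hR hK hKL

lemma transc_case (z : ℂ) (hz : Transcendental ℚ z) : ∃ φ : ℂ →+* ℂ, φ z = 2 * z := by
  have hz2 : Transcendental ℚ (2 * z) := by
    intro h
    apply hz
    have h2 : IsAlgebraic ℚ ((1 / 2 : ℚ) : ℂ) := isAlgebraic_algebraMap (1 / 2 : ℚ)
    have := h2.mul h
    have e : ((1 / 2 : ℚ) : ℂ) * (2 * z) = z := by
      push_cast
      ring
    rwa [e] at this
  obtain ⟨φ, hφ⟩ := exists_ext_equiv' (R := Polynomial ℚ) (K := ℂ) (L := ℂ)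
    (Polynomial.aeval (R := ℚ) z).toRingHom (Polynomial.aeval (R := ℚ) (2 * z)).toRingHom
    (transcendental_iff_injective.1 hz) (transcendental_iff_injective.1 hz2)
    (by simp)
    (by rw [Cardinal.mk_complex]; exact Cardinal.aleph0_lt_continuum) rfl
  exact ⟨φ, by simpa using hφ Polynomial.X⟩

lemma padic_root (q : Polynomial ℚ) (hq : q.Monic) (h : ¬ ∃ r : Polynomial ℤ, r.map (Int.castRingHom ℚ) = q) :
    ∃ (p : ℕ) (_ : Fact p.Prime) (x : PadicAlgCl p), Polynomial.aeval x q = 0 ∧ 1 < ‖x‖ := by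
  have : ∃ i, ¬ ∃ m : ℤ, (m : ℚ) = q.coeff i := by
    by_contra! hc
    exact h ((Polynomial.mem_lifts _).1 ((Polynomial.lifts_iff_coeff_lifts _).2 fun i => hc i))
  obtain ⟨i, hi⟩ := this
  have : ∃ (p : ℕ) (_ : Fact p.Prime), 1 < ‖((q.coeff i : ℚ) : ℚ_[p])‖ := by
    set a := q.coeff i
    have ha : a.den ≠ 1 := fun h1 => hi ⟨a.num, by exact (Rat.den_eq_one_iff a).1 h1⟩
    obtain ⟨p, hp, hpd⟩ := Nat.exists_prime_and_dvd ha
    have : Fact p.Prime := ⟨hp⟩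
    refine ⟨p, ⟨hp⟩, ?_⟩
    by_contra hc
    push Not at hc
    have e : (a : ℚ_[p]) * ((a.den : ℤ) : ℚ_[p]) = ((a.num : ℤ) : ℚ_[p]) := by
      exact_mod_cast congrArg (fun x : ℚ => (x : ℚ_[p])) (Rat.mul_den_eq_num a)
    have h1 : ‖((a.den : ℤ) : ℚ_[p])‖ < 1 :=
      Padic.norm_intCast_lt_one_iff |>.2 (by exact_mod_cast hpd)
    have h2 : ‖((a.num : ℤ) : ℚ_[p])‖ < 1 := by
      rw [← e, norm_mul]
      exact mul_lt_one_of_nonneg_of_lt_one_right hc (norm_nonneg _) h1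
    have h3 := Padic.norm_intCast_lt_one_iff.1 h2
    have h4 : p ∣ a.num.natAbs := Int.natCast_dvd.1 h3
    exact hp.one_lt.ne' (Nat.eq_one_of_dvd_coprimes a.reduced h4 hpd)
  obtain ⟨p, hp, hpi⟩ := this
  refine ⟨p, hp, ?_⟩
  by_contra! hc
  have hsp := IsAlgClosed.splits (q.map (algebraMap ℚ (PadicAlgCl p)))
  let O : Subring (PadicAlgCl p) := (Valued.v : Valuation (PadicAlgCl p) NNReal).integer
  have hO : ∀ x, x ∈ O ↔ ‖x‖ ≤ 1 := fun x => by
    rw [Valuation.mem_integer_iff, PadicAlgCl.valuation_def]; rfl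
  have hm := hq.map (algebraMap ℚ (PadicAlgCl p))
  have hprod := hsp.eq_prod_roots_of_monic hm
  have hl : q.map (algebraMap ℚ (PadicAlgCl p)) ∈ Polynomial.lifts O.subtype := by
    rw [hprod]
    apply Subsemiring.multiset_prod_mem
    intro c hc'
    obtain ⟨x, hx, rfl⟩ := Multiset.mem_map.1 hc'
    have hx0 : Polynomial.aeval x q = 0 := by
      have := (Polynomial.mem_roots'.1 hx).2
      rwa [Polynomial.IsRoot, Polynomial.eval_map_algebraMap] at this
    refine (Polynomial.mem_lifts _).2 ⟨Polynomial.X - Polynomial.C ⟨x, (hO x).2 (hc x hx0)⟩, ?_⟩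
    simp
  obtain ⟨y, hy⟩ := (Polynomial.lifts_iff_coeff_lifts _).1 hl i
  have h1 := (hO y).1 y.2
  have h2 : (y : PadicAlgCl p) = algebraMap ℚ_[p] (PadicAlgCl p) ((q.coeff i : ℚ) : ℚ_[p]) := by
    have : (y : PadicAlgCl p) = algebraMap ℚ (PadicAlgCl p) (q.coeff i) := by
      rw [← Polynomial.coeff_map]; exact hy
    rw [this]; simp
  rw [h2] at h1
  have h3 := PadicAlgCl.norm_extends p ((q.coeff i : ℚ) : ℚ_[p])
  exact absurd (h3.symm.le.trans h1) (not_le.2 hpi)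

/-- The main arithmetic input. -/
lemma exists_norm_ne_one (z : ℂ) (hz : ∀ n : ℕ, 0 < n → z ^ n ≠ 1) :
    ∃ (F : Type) (_ : NormedField F) (φ : ℂ →+* F), ‖φ z‖ ≠ 1 := by
  by_cases hn : ‖z‖ = 1
  swap
  · exact ⟨ℂ, inferInstance, RingHom.id ℂ, hn⟩
  by_cases ha : IsAlgebraic ℚ z
  swap
  · obtain ⟨φ, hφ⟩ := transc_case z ha
    exact ⟨ℂ, inferInstance, φ, by rw [hφ, norm_mul, hn]; norm_num⟩
  have hi : IsIntegral ℚ z := ha.isIntegral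
  let K := IntermediateField.adjoin ℚ {z}
  have : FiniteDimensional ℚ K := IntermediateField.adjoin.finiteDimensional hi
  have : NumberField K := { to_charZero := inferInstance, to_finiteDimensional := inferInstance }
  let x : K := IntermediateField.AdjoinSimple.gen ℚ z
  have hx : algebraMap K ℂ x = z := IntermediateField.AdjoinSimple.algebraMap_gen ℚ z
  by_cases hZ : IsIntegral ℤ z
  · have hxZ : IsIntegral ℤ x := by
      rw [← isIntegral_algebraMap_iff (algebraMap K ℂ).injective, hx]; exact hZ
    by_contra! hc
    obtain ⟨n, hn, hxn⟩ := NumberField.Embeddings.pow_eq_one_of_norm_eq_one K ℂ hxZ (fun g => by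
      obtain ⟨φ, hφ⟩ := ext_of_emb rfl z hi g
      rw [← hφ]
      exact hc ℂ inferInstance φ)
    apply hz n hn
    rw [← hx, ← map_pow, hxn, map_one]
  · have : ¬ ∃ r : Polynomial ℤ, r.map (Int.castRingHom ℚ) = minpoly ℚ z := by
      rintro ⟨r, hr⟩
      apply hZ
      refine ⟨r, ?_, ?_⟩
      · apply Polynomial.monic_of_injective (RingHom.injective_int (Int.castRingHom ℚ))
        rw [hr]; exact minpoly.monic hi
      · have := minpoly.aeval ℚ z
        rw [← hr, Polynomial.aeval_def, Polynomial.eval₂_map] at this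
        have e : algebraMap ℤ ℂ = (algebraMap ℚ ℂ).comp (Int.castRingHom ℚ) := RingHom.ext_int _ _
        rw [e]
        exact this
    obtain ⟨p, hp, y, hy, hy1⟩ := padic_root (minpoly ℚ z) (minpoly.monic hi) this
    have hyr : y ∈ (minpoly ℚ x).rootSet (PadicAlgCl p) := by
      rw [Polynomial.mem_rootSet]
      refine ⟨minpoly.ne_zero (Algebra.IsIntegral.isIntegral x), ?_⟩
      rw [← minpoly.algebraMap_eq (algebraMap K ℂ).injective x, hx]
      exact hy
    rw [← NumberField.Embeddings.range_eval_eq_rootSet_minpoly] at hyr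
    obtain ⟨g, hg⟩ := hyr
    obtain ⟨φ, hφ⟩ := ext_of_emb (card_padic p) z hi g
    refine ⟨PadicAlgCl p, inferInstance, φ, ?_⟩
    rw [hφ]
    change ‖g x‖ ≠ 1
    simp only at hg
    rw [hg]
    exact hy1.ne'

end Arith

lemma wordLength_spec {G : Type*} [Group G] (S : Set G) (hS : Subgroup.closure S = ⊤) (g : G) :
    ∃ l : List G, l.length = wordLength S g ∧ (∀ x ∈ l, x ∈ S ∨ x⁻¹ ∈ S) ∧ l.prod = g := by
  apply Nat.sInf_mem (s := {n | ∃ l : List G, l.length = n ∧ (∀ x ∈ l, x ∈ S ∨ x⁻¹ ∈ S) ∧ l.prod = g})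
  have hg : g ∈ Subgroup.closure S := hS ▸ Subgroup.mem_top g
  rw [← Subgroup.mem_toSubmonoid, Subgroup.closure_toSubmonoid] at hg
  obtain ⟨l, h1, h2⟩ := Submonoid.exists_list_of_mem_closure hg
  exact ⟨l.length, l, rfl, fun x hx => by simpa using h1 x hx, h2⟩

lemma subadd_pow {G : Type*} [Group G] (L : G → ℝ) (hL : ∀ g h, L (g * h) ≤ L g + L h)
    (g : G) (k : ℕ) (hk : 0 < k) : L (g ^ k) ≤ k * L g := by
  induction k, hk using Nat.le_induction with
  | base => simp
  | succ k hk ih =>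
    rw [pow_succ]
    have := hL (g ^ k) g
    push_cast
    linarith

lemma undist_aux {G : Type*} [Group G] (γ : G) (L : G → ℝ) (hL : ∀ g h, L (g * h) ≤ L g + L h)
    (hsymm : ∀ g, L g⁻¹ = L g)
    (k : ℕ) (hk : 0 < k) (a : ℝ) (ha : 0 < a) (h : ∀ n : ℕ, 0 < n → a * n ≤ L (γ ^ (n * k))) 
    (S : Set G) (hf : S.Finite) (hS : Subgroup.closure S = ⊤) : 
    ∃ c : ℝ, 0 < c ∧ ∀ n : ℤ, c * |(n : ℝ)| ≤ (wordLength S (γ ^ n) : ℝ) := by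
  obtain ⟨M, hM⟩ := (hf.image L).bddAbove
  have hM' : ∀ x, (x ∈ S ∨ x⁻¹ ∈ S) → L x ≤ max M 1 := by
    rintro x (hx | hx)
    · exact le_max_of_le_left (hM ⟨x, hx, rfl⟩)
    · exact le_max_of_le_left (hM ⟨x⁻¹, hx, hsymm x⟩)
  set N := max M 1
  have hN : 0 < N := lt_of_lt_of_le one_pos (le_max_right _ _)
  have hl : ∀ l : List G, l ≠ [] → (∀ x ∈ l, x ∈ S ∨ x⁻¹ ∈ S) → L l.prod ≤ N * l.length := by
    intro l
    induction l with
    | nil => simp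
    | cons x l ih =>
      intro _ hx
      by_cases hl : l = []
      · subst hl
        simpa using hM' x (hx x (by simp))
      · have h1 := ih hl (fun y hy => hx y (by simp [hy]))
        have h2 := hM' x (hx x (by simp))
        have h3 := hL x l.prod
        simp only [List.prod_cons, List.length_cons]
        push_cast
        linarith
  have hk' : (0 : ℝ) < k := by exact_mod_cast hk
  have key : ∀ n : ℕ, 0 < n → a * n ≤ k * L (γ ^ n) := fun n hn => by
    refine (h n hn).trans ?_
    rw [pow_mul]
    exact subadd_pow L hL _ k hk
  refine ⟨a / (k * N), by positivity, fun n => ?_⟩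
  by_cases hn : n = 0
  · simp [hn]
  obtain ⟨l, h1, h2, h3⟩ := wordLength_spec S hS (γ ^ n)
  have hn' : 0 < n.natAbs := Int.natAbs_pos.2 hn
  have e : L (γ ^ n) = L (γ ^ n.natAbs) := by
    rcases Int.natAbs_eq n with h | h
    · conv_lhs => rw [h, zpow_natCast]
    · conv_lhs => rw [h, zpow_neg, zpow_natCast, hsymm]
  have hk1 := key _ hn'
  have habs : ((n.natAbs : ℕ) : ℝ) = |(n : ℝ)| := by rw [Nat.cast_natAbs, Int.cast_abs]
  rw [habs, ← e] at hk1
  have hnpos : 0 < |(n : ℝ)| := by rw [← habs]; exact_mod_cast hn'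
  have hne : l ≠ [] := by
    rintro rfl
    simp only [List.prod_nil] at h3
    rw [← h3] at hk1
    have h11 : L (1 : G) ≤ 0 := by
      -- γ ^ n = 1 forces boundedness of L on powers
      by_contra hc
      have hall : ∀ m : ℕ, 0 < m → a * (n.natAbs * m : ℕ) ≤ k * L 1 := by
        intro m hm
        have := key (n.natAbs * m) (Nat.mul_pos hn' hm)
        rw [pow_mul] at this
        have e1 : γ ^ n.natAbs = 1 := by
          rcases Int.natAbs_eq n with h | h
          · rw [h, zpow_natCast] at h3; exact h3.symm
          · rw [h, zpow_neg, zpow_natCast] at h3; exact inv_eq_one.1 h3.symm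
        rwa [e1, one_pow] at this
      obtain ⟨m, hm⟩ := exists_nat_gt (k * L 1 / a)
      have hm0 : 0 < m := by
        have : (0 : ℝ) < m := lt_of_le_of_lt (by push Not at hc; positivity) hm
        exact_mod_cast this
      have h5 := hall m hm0
      rw [div_lt_iff₀ ha] at hm
      have h6 : (m : ℝ) ≤ (n.natAbs * m : ℕ) := by
        exact_mod_cast Nat.le_mul_of_pos_left m hn'
      nlinarith
    have : 0 < a * |(n : ℝ)| := by positivity
    nlinarith
  have h4 := hl l hne h2
  rw [h3, h1] at h4
  rw [div_mul_eq_mul_div, div_le_iff₀ (by positivity)]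
  calc _ ≤ _ := hk1
    _ ≤ k * (N * wordLength S (γ ^ n)) := by gcongr
    _ = _ := by ring

lemma undist {G : Type*} [Group G] (γ : G) (L : G → ℝ) (hL : ∀ g h, L (g * h) ≤ L g + L h)
    (k : ℕ) (hk : 0 < k) (a : ℝ) (ha : 0 < a)
    (h : (∀ n : ℕ, 0 < n → a * n ≤ L (γ ^ (n * k))) ∨ ∀ n : ℕ, 0 < n → a * n ≤ L (γ⁻¹ ^ (n * k))) 
    (S : Set G) (hf : S.Finite) (hS : Subgroup.closure S = ⊤) : 
    ∃ c : ℝ, 0 < c ∧ ∀ n : ℤ, c * |(n : ℝ)| ≤ (wordLength S (γ ^ n) : ℝ) := by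
  refine undist_aux γ (fun g => max (L g) (L g⁻¹)) ?_ ?_ k hk a ha ?_ S hf hS
  · intro g h
    have h1 := hL g h
    have h2 := hL h⁻¹ g⁻¹
    rw [← mul_inv_rev] at h2
    exact max_le (h1.trans (add_le_add (le_max_left _ _) (le_max_left _ _)))
      (h2.trans (by rw [add_comm]; exact (add_le_add (le_max_right _ _) (le_max_right _ _))))
  · intro g
    simp [max_comm]
  · intro n hn
    rcases h with h | h
    · exact (h n hn).trans (le_max_left _ _)
    · refine (h n hn).trans ?_
      rw [inv_pow]
      exact le_max_right _ _

open Matrix in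
attribute [local instance] Matrix.linftyOpNormedRing in
lemma matrix_case {G : Type*} [Group G] (γ : G) {d : ℕ} {F : Type*} [NormedField F]
    (ρ : G →* Matrix (Fin d) (Fin d) F) (μ : F) (hμ : (ρ γ).charpoly.IsRoot μ) (hn : ‖μ‖ ≠ 1)
    (S : Set G) (hf : S.Finite) (hS : Subgroup.closure S = ⊤) : 
    ∃ c : ℝ, 0 < c ∧ ∀ n : ℤ, c * |(n : ℝ)| ≤ (wordLength S (γ ^ n) : ℝ) := by
  have hbound : ∀ (A : Matrix (Fin d) (Fin d) F) (x : F), x ∈ spectrum F A → ‖x‖ ≤ ‖A‖ := by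
    intro A x hx
    rw [← Matrix.spectrum_toLin', ← Module.End.hasEigenvalue_iff_mem_spectrum] at hx
    obtain ⟨v, hv⟩ := hx.exists_hasEigenvector
    have h1 : A *ᵥ v = x • v := by simpa using hv.apply_eq_smul
    have h2 := Matrix.linfty_opNorm_mulVec A v
    rw [h1, norm_smul] at h2
    exact le_of_mul_le_mul_right h2 (norm_pos_iff.2 hv.2)
  have hsp : μ ∈ spectrum F (ρ γ) := Matrix.mem_spectrum_iff_isRoot_charpoly.2 hμ
  have hnt : Nontrivial (Matrix (Fin d) (Fin d) F) := by
    by_contra hc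
    rw [not_nontrivial_iff_subsingleton] at hc
    simp [spectrum.of_subsingleton] at hsp
  have hne : ∀ g, ρ g ≠ 0 := fun g hg => by
    have : ρ g * ρ g⁻¹ = 1 := by rw [← map_mul]; simp
    rw [hg, zero_mul] at this
    exact zero_ne_one this
  have hpos : ∀ g, 0 < ‖ρ g‖ := fun g => norm_pos_iff.2 (hne g)
  have hμ0 : μ ≠ 0 := by
    rintro rfl
    rw [spectrum.zero_mem_iff] at hsp
    exact hsp ((Group.isUnit γ).map ρ)
  have hμpos : 0 < ‖μ‖ := norm_pos_iff.2 hμ0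
  have hlog : Real.log ‖μ‖ ≠ 0 := by
    intro h
    rcases Real.log_eq_zero.1 h with h | h | h
    · linarith
    · exact hn h
    · linarith
  have hsp' : μ⁻¹ ∈ spectrum F (ρ γ⁻¹) := by
    let u : (Matrix (Fin d) (Fin d) F)ˣ := Units.map ρ (toUnits γ)
    exact (spectrum.inv_mem_iff (R := F) (r := Units.mk0 μ hμ0) (a := u)).1 hsp
  refine undist γ (fun g => Real.log ‖ρ g‖) ?_ 1 one_pos |Real.log ‖μ‖| (abs_pos.2 hlog) ?_ S hf hS
  · intro g h
    rw [map_mul, ← Real.log_mul (hpos g).ne' (hpos h).ne']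
    exact Real.log_le_log (by rw [← map_mul]; exact hpos _) (norm_mul_le _ _)
  · have key : ∀ (g : G) (x : F), x ≠ 0 → x ∈ spectrum F (ρ g) → ∀ n : ℕ, Real.log ‖x‖ * n ≤ Real.log ‖ρ (g ^ (n * 1))‖ := by
      intro g x hx hxs n
      have := hbound _ _ (spectrum.pow_mem_pow (ρ g) n hxs)
      rw [mul_one, map_pow, mul_comm, ← Real.log_pow, ← norm_pow]
      exact Real.log_le_log (norm_pos_iff.2 (pow_ne_zero _ hx)) this
    rcases abs_choice (Real.log ‖μ‖) with h | h
    · left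
      intro n _
      rw [h]
      exact key γ μ hμ0 hsp n
    · right
      intro n _
      have := key γ⁻¹ μ⁻¹ (inv_ne_zero hμ0) hsp' n
      rwa [norm_inv, Real.log_inv, ← h] at this

lemma finite_case {d : ℕ} (A : Matrix (Fin d) (Fin d) ℝ) (hA : A ∈ Matrix.unitaryGroup (Fin d) ℝ)
    (h : ∀ z : ℂ, (A.map (algebraMap ℝ ℂ)).charpoly.IsRoot z → ∃ n : ℕ, 0 < n ∧ z ^ n = 1) :
    ∃ k : ℕ, 0 < k ∧ A ^ k = 1 := by
  set B := A.map (algebraMap ℝ ℂ) with hB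
  have hroot : ∀ z ∈ B.charpoly.roots, ∃ n : ℕ, 0 < n ∧ z ^ n = 1 := fun z hz =>
    h z (Polynomial.mem_roots'.1 hz).2
  obtain ⟨k, hk, hkz⟩ : ∃ k : ℕ, 0 < k ∧ ∀ z ∈ B.charpoly.roots, z ^ k = 1 := by
    generalize B.charpoly.roots = s at hroot
    induction s using Multiset.induction_on with
    | empty => exact ⟨1, one_pos, by simp⟩
    | cons a s ih =>
      obtain ⟨k, hk, hks⟩ := ih fun z hz => hroot z (Multiset.mem_cons_of_mem hz)
      obtain ⟨n, hn, hna⟩ := hroot a (Multiset.mem_cons_self a s)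
      refine ⟨n * k, Nat.mul_pos hn hk, fun z hz => ?_⟩
      rcases Multiset.mem_cons.1 hz with rfl | hz
      · rw [pow_mul, hna, one_pow]
      · rw [mul_comm, pow_mul, hks z hz, one_pow]
  refine ⟨k, hk, ?_⟩
  have hspec : ∀ z ∈ (B ^ k).charpoly.roots, z = 1 := by
    intro z hz
    have h1 := Matrix.mem_spectrum_iff_isRoot_charpoly.2 (Polynomial.mem_roots'.1 hz).2
    rw [spectrum.map_pow_of_pos B hk] at h1
    obtain ⟨w, hw, rfl⟩ := h1
    exact hkz w (Polynomial.mem_roots'.2 ⟨(Matrix.charpoly_monic B).ne_zero,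
      Matrix.mem_spectrum_iff_isRoot_charpoly.1 hw⟩)
  have htr : (B ^ k).trace = d := by
    rw [Matrix.trace_eq_sum_roots_charpoly, Multiset.eq_replicate_card.2 hspec,
      IsAlgClosed.card_roots_eq_natDegree]
    simp [Matrix.charpoly_natDegree_eq_dim]
  have hBk : B ^ k = (A ^ k).map (algebraMap ℝ ℂ) := by
    exact (map_pow (algebraMap ℝ ℂ).mapMatrix A k).symm
  have htrA : (A ^ k).trace = d := by
    rw [hBk, ← AddMonoidHom.map_trace (algebraMap ℝ ℂ)] at htr
    apply Complex.ofReal_injective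
    simpa using htr
  have hU := pow_mem hA k
  set C := A ^ k
  have h1 : star C * C = 1 := Matrix.mem_unitaryGroup_iff'.1 hU
  have h2 : ((C - 1).conjTranspose * (C - 1)).trace = 0 := by
    rw [← Matrix.star_eq_conjTranspose, star_sub, star_one]
    have : (star C - 1) * (C - 1) = 1 - C - star C + 1 := by
      rw [sub_mul, mul_sub, h1]; noncomm_ring
    rw [this, Matrix.trace_add, Matrix.trace_sub, Matrix.trace_sub, Matrix.star_eq_conjTranspose,
      Matrix.trace_conjTranspose, htrA, Matrix.trace_one]
    simp
  rw [Matrix.trace_conjTranspose_mul_self_eq_zero_iff] at h2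
  exact sub_eq_zero.1 h2

noncomputable def linMat (d : ℕ) :
    (EuclideanSpace ℝ (Fin d) ≃ᵢ EuclideanSpace ℝ (Fin d)) →* Matrix (Fin d) (Fin d) ℝ where
  toFun g := LinearMap.toMatrixAlgEquiv (EuclideanSpace.basisFun (Fin d) ℝ).toBasis
    (g.toRealLinearIsometryEquiv.toLinearEquiv : EuclideanSpace ℝ (Fin d) →ₗ[ℝ] EuclideanSpace ℝ (Fin d))
  map_one' := by
    rw [← map_one (LinearMap.toMatrixAlgEquiv (EuclideanSpace.basisFun (Fin d) ℝ).toBasis)]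
    congr 1
    apply LinearMap.ext
    intro x
    change IsometryEquiv.toRealLinearIsometryEquiv 1 x = x
    rw [IsometryEquiv.toRealLinearIsometryEquiv_apply]
    simp
  map_mul' g h := by
    rw [← map_mul (LinearMap.toMatrixAlgEquiv (EuclideanSpace.basisFun (Fin d) ℝ).toBasis)]
    congr 1
    apply LinearMap.ext
    intro x
    change IsometryEquiv.toRealLinearIsometryEquiv (g * h) x =
      g.toRealLinearIsometryEquiv (h.toRealLinearIsometryEquiv x)
    rw [IsometryEquiv.toRealLinearIsometryEquiv_apply h, map_sub]
    simp [IsometryEquiv.toRealLinearIsometryEquiv_apply]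

lemma linMat_unitary (d : ℕ) (g) : linMat d g ∈ Matrix.unitaryGroup (Fin d) ℝ :=
  g.toRealLinearIsometryEquiv.toMatrix_mem_unitaryGroup _ _

lemma linMat_eq_one (d : ℕ) (g) (h : linMat d g = 1) (x : EuclideanSpace ℝ (Fin d)) :
    g x = x + g 0 := by
  have : LinearMap.toMatrixAlgEquiv (EuclideanSpace.basisFun (Fin d) ℝ).toBasis
    (g.toRealLinearIsometryEquiv.toLinearEquiv : EuclideanSpace ℝ (Fin d) →ₗ[ℝ] EuclideanSpace ℝ (Fin d)) = 1 := h
  rw [← map_one (LinearMap.toMatrixAlgEquiv (EuclideanSpace.basisFun (Fin d) ℝ).toBasis)] at this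
  have h2 := LinearMap.congr_fun ((LinearMap.toMatrixAlgEquiv _).injective this) x
  have h3 : g.toRealLinearIsometryEquiv x = x := h2
  rw [IsometryEquiv.toRealLinearIsometryEquiv_apply] at h3
  rw [← h3]; simp
  rw [h3]

/-- If `G` is a finitely generated group of isometries of Euclidean space `ℝ^d` and
`γ ∈ G` has infinite order, then `⟨γ⟩` is undistorted in `G`: for any finite generating
set `S` of `G` there is `c > 0` with `l_S(γⁿ) ≥ c·|n|` for all integers `n`. -/
theorem stmt_18 {d : ℕ} (hd : 0 < d)
    (G : Subgroup (EuclideanSpace ℝ (Fin d) ≃ᵢ EuclideanSpace ℝ (Fin d)))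
    (hfg : G.FG) (γ : ↥G) (hγ : ¬ IsOfFinOrder γ) :
    ∀ S : Set ↥G, S.Finite → Subgroup.closure S = ⊤ →
      ∃ c : ℝ, 0 < c ∧ ∀ n : ℤ, c * |(n : ℝ)| ≤ (wordLength S (γ ^ n) : ℝ) := by
  intro S hf hS
  by_cases h : ∀ z : ℂ, ((linMat d γ).map (algebraMap ℝ ℂ)).charpoly.IsRoot z →
      ∃ n : ℕ, 0 < n ∧ z ^ n = 1
  · obtain ⟨k, hk, hA⟩ := finite_case _ (linMat_unitary d γ) h
    rw [← map_pow] at hA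
    set t : EuclideanSpace ℝ (Fin d) ≃ᵢ EuclideanSpace ℝ (Fin d) := γ.1 ^ k with ht
    have htr := linMat_eq_one d _ hA
    have hv : t 0 ≠ 0 := by
      intro h0
      apply hγ
      rw [isOfFinOrder_iff_pow_eq_one]
      refine ⟨k, hk, Subtype.ext ?_⟩
      change t = 1
      ext1 x
      rw [htr x, h0]
      simp
    refine undist γ (fun g => ‖g.1 0‖) ?_ k hk ‖t 0‖ (norm_pos_iff.2 hv) (Or.inl ?_) S hf hS
    · intro g h
      have e : (g * h).1 0 = (g.1 (h.1 0) - g.1 0) + g.1 0 := by simp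
      have e2 : ‖g.1 (h.1 0) - g.1 0‖ = ‖h.1 0‖ := by
        rw [← dist_eq_norm, g.1.isometry.dist_eq, dist_zero_right]
      change ‖(g * h).1 0‖ ≤ _
      rw [e]
      refine (norm_add_le _ _).trans ?_
      rw [e2, add_comm]
    · have hp : ∀ n : ℕ, (t ^ n) 0 = (n : ℝ) • t 0 := by
        intro n
        induction n with
        | zero => simp
        | succ n ih =>
          rw [pow_succ', IsometryEquiv.mul_apply, ih, htr]
          push_cast
          rw [add_smul, one_smul]
      intro n _
      have e : (γ ^ (n * k)).1 = t ^ n := by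
        rw [mul_comm, pow_mul]; rfl
      simp only [e, hp, norm_smul]
      rw [mul_comm]
      simp
  · push Not at h
    obtain ⟨z, hz, hzn⟩ := h
    obtain ⟨F, _, φ, hφ⟩ := exists_norm_ne_one z hzn
    refine matrix_case γ ((((φ.comp (algebraMap ℝ ℂ)).mapMatrix : Matrix (Fin d) (Fin d) ℝ →+* _) :
      Matrix (Fin d) (Fin d) ℝ →* Matrix (Fin d) (Fin d) F).comp ((linMat d).comp G.subtype))
      (φ z) ?_ hφ S hf hS
    have e : ((linMat d γ).map (algebraMap ℝ ℂ)).map φ = (((φ.comp (algebraMap ℝ ℂ)).mapMatrix : Matrix (Fin d) (Fin d) ℝ →+* _) :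
      Matrix (Fin d) (Fin d) ℝ →* Matrix (Fin d) (Fin d) F).comp ((linMat d).comp G.subtype) γ := by
      ext i j; simp
    rw [← e, Matrix.charpoly_map]
    exact hz.map
end
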